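/- Let d ≥ 1 and let Δ be a flag simplicial complex of dimension d−1 whose geometric realization is homeomorphic to the sphere S^{d−1}, with at most 2d+2 vertices (equivalently γ_1(Δ) ≤ 2). Then the γ-polynomial of Δ is one of 1, 1+t, 1+2t, 1+2t+t², and in particular γ(Δ) satisfies the Kruskal–Katona inequalities (it is the f-vector of a simplicial complex). Moreover, each of the polynomials 1, 1+t, 1+2t, and 1+2t+t² occurs as γ(Δ;t) for some flag simplicial complex Δ whose geometric realization is a sphere (e.g., for the boundary of the cross-polytope, the boundary of the pentagon, the boundary of the hexagon, and the join of the boundaries of two pentagons, respectively). -/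

import Mathlib

open Polynomial Finset

/-- The geometric realization of a simplicial complex `Δ` with vertices `Fin N`:
the points of the standard simplex on the vertex set whose support is a face. -/
def realize {N : ℕ} (Δ : Finset (Finset (Fin N))) : Set (Fin N → ℝ) :=
  {x | ∃ F ∈ Δ, (∀ v, 0 ≤ x v) ∧ (∀ v, x v ≠ 0 → v ∈ F) ∧ (∑ v, x v) = 1}

/-- The `h`-polynomial `h(Δ;t) = (1-t)^d f(Δ; t/(1-t)) = Σ_{F ∈ Δ} t^{|F|} (1-t)^{d-|F|}`
of a `(d-1)`-dimensional simplicial complex. -/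
noncomputable def hPoly (d : ℕ) {N : ℕ} (Δ : Finset (Finset (Fin N))) : Polynomial ℤ :=
  ∑ F ∈ Δ, X ^ F.card * (1 - X) ^ (d - F.card)

section Brouwer

variable {E : Type*} [NormedAddCommGroup E] [InnerProductSpace ℝ E]

/-- Extrapolation of polynomials of bounded degree to the value at `1`. -/
theorem exists_weights_eval_one_eq_sum {n : ℕ} {s : Finset ℝ} (hs : #s = n + 1) :
    ∃ w : ℝ → ℝ, ∑ t ∈ s, w t = 1 ∧
      ∀ P : ℝ[X], P.degree < (n + 1 : ℕ) → P.eval 1 = ∑ t ∈ s, w t * P.eval t := by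
  have hne : s.Nonempty := card_pos.mp (by omega)
  have inj : Set.InjOn (id : ℝ → ℝ) (s : Set ℝ) := Function.injective_id.injOn
  refine ⟨fun t => (Lagrange.basis s id t).eval 1, ?_, fun P hP => ?_⟩
  · rw [← eval_finsetSum, Lagrange.sum_basis inj hne, eval_one]
  · rw [← hs] at hP
    conv_lhs => rw [Lagrange.eq_interpolate inj hP, Lagrange.interpolate_apply]
    simp [eval_finsetSum, mul_comm]

open MeasureTheory Metric Set Filter Topology

/-- Extending by zero a map on the closed unit ball which vanishes on the sphere keeps
Lipschitz bounds. -/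
theorem norm_indicator_closedBall_sub_le {g : E → E} {L : ℝ} (hL : 0 ≤ L)
    (hg : ∀ x ∈ closedBall (0 : E) 1, ∀ y ∈ closedBall (0 : E) 1, ‖g x - g y‖ ≤ L * ‖x - y‖)
    (h0 : ∀ x ∈ sphere (0 : E) 1, g x = 0) (x y : E) :
    ‖(closedBall (0 : E) 1).indicator g x - (closedBall (0 : E) 1).indicator g y‖
      ≤ L * ‖x - y‖ := by
  have key : ∀ x ∈ closedBall (0 : E) 1, ∀ y ∉ closedBall (0 : E) 1, ‖g x‖ ≤ L * ‖x - y‖ := by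
    intro x hx y hy
    have hx' : ‖x‖ ≤ 1 := by simpa using hx
    have hy' : 1 ≤ ‖y‖ := by simpa using (not_le.mp (by simpa using hy)).le
    have hc : ContinuousOn (fun t : ℝ => ‖x + t • (y - x)‖) (Icc 0 1) := by fun_prop
    obtain ⟨t, ht, h1⟩ := intermediate_value_Icc zero_le_one hc
      (show (1 : ℝ) ∈ _ by simp [hx', hy'])
    have hz : x + t • (y - x) ∈ sphere (0 : E) 1 := by simpa using h1
    have := hg x hx _ (sphere_subset_closedBall hz)
    rw [h0 _ hz, sub_zero] at this
    refine this.trans (mul_le_mul_of_nonneg_left ?_ hL)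
    rw [sub_add_cancel_left, norm_neg, norm_smul, Real.norm_of_nonneg ht.1, norm_sub_rev x y]
    exact mul_le_of_le_one_left (norm_nonneg _) ht.2
  by_cases hx : x ∈ closedBall (0 : E) 1 <;> by_cases hy : y ∈ closedBall (0 : E) 1
  · rw [indicator_of_mem hx, indicator_of_mem hy]; exact hg x hx y hy
  · rw [indicator_of_mem hx, indicator_of_notMem hy, sub_zero]; exact key x hx y hy
  · rw [indicator_of_notMem hx, indicator_of_mem hy, zero_sub, norm_neg, norm_sub_rev]
    exact key y hy x hx
  · rw [indicator_of_notMem hx, indicator_of_notMem hy]; simpa using by positivity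

/-- The radial projection onto the closed unit ball. -/
theorem exists_continuous_projection_closedBall :
    ∃ π : E → E, Continuous π ∧ (∀ x, π x ∈ closedBall (0 : E) 1) ∧
      ∀ x ∈ closedBall (0 : E) 1, π x = x := by
  refine ⟨fun x => (max 1 ‖x‖)⁻¹ • x, ?_, fun x => ?_, fun x hx => ?_⟩
  · refine Continuous.smul (Continuous.inv₀ (continuous_const.max continuous_norm) fun x => ?_)
      continuous_id
    have := le_max_left 1 ‖x‖
    positivity
  · rw [mem_closedBall_zero_iff, norm_smul, norm_inv, Real.norm_of_nonneg (by positivity)]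
    exact inv_mul_le_one_of_le₀ (le_max_right _ _) (by positivity)
  · simp only [max_eq_left (mem_closedBall_zero_iff.mp hx), inv_one, one_smul]

variable [FiniteDimensional ℝ E]

theorem exists_polynomial_eval_eq_det_one_add_smul (A : E →L[ℝ] E) :
    ∃ P : ℝ[X], P.degree < (Module.finrank ℝ E + 1 : ℕ) ∧
      ∀ t : ℝ, P.eval t = (1 + t • A : E →L[ℝ] E).det := by
  let b := Module.finBasis ℝ E
  let M := LinearMap.toMatrix b b (A : E →ₗ[ℝ] E)
  refine ⟨Matrix.det ((X : ℝ[X]) • M.map C + (1 : Matrix _ _ ℝ).map C), ?_, ?_⟩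
  · refine lt_of_le_of_lt degree_le_natDegree ?_
    have := Polynomial.natDegree_det_X_add_C_le M 1
    simp only [Fintype.card_fin] at this
    exact_mod_cast Nat.lt_succ_of_le this
  · intro t
    rw [← Polynomial.coe_evalRingHom, RingHom.map_det, ContinuousLinearMap.det,
      ← LinearMap.det_toMatrix b]
    congr 1
    have h : LinearMap.toMatrix b b ((1 + t • A : E →L[ℝ] E) : E →ₗ[ℝ] E) = 1 + t • M := by
      rw [ContinuousLinearMap.toLinearMap_add, ContinuousLinearMap.toLinearMap_smul,
        map_add, map_smul]
      congr 1
      exact LinearMap.toMatrix_one b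
    rw [h]
    ext i j
    rcases eq_or_ne i j with rfl | hij
    · simp [add_comm, mul_comm _ t]
    · simp [Matrix.one_apply_ne hij, mul_comm _ t]

theorem det_eq_zero_of_norm_eq_one {r : E → E} {x : E}
    (hr : DifferentiableAt ℝ r x) (h : ∀ᶠ y in 𝓝 x, ‖r y‖ = 1) : (fderiv ℝ r x).det = 0 := by
  by_contra hdet
  have hu : IsUnit (LinearMap.det (fderiv ℝ r x : E →ₗ[ℝ] _)) :=
    isUnit_iff_ne_zero.mpr hdet
  have hsurj := (LinearMap.isUnit_iff_range_eq_top _).mp ((LinearMap.isUnit_iff_isUnit_det _).mpr hu)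
  obtain ⟨v, hv⟩ := LinearMap.range_eq_top.mp hsurj (r x)
  have hv' : fderiv ℝ r x v = r x := hv
  have h1 := (hr.hasFDerivAt.norm_sq)
  have h2 : HasFDerivAt (fun y => ‖r y‖ ^ 2) (0 : E →L[ℝ] ℝ) x := by
    refine (hasFDerivAt_const (1 : ℝ) x).congr_of_eventuallyEq ?_
    filter_upwards [h] with y hy
    simp [hy]
  have h3 := congrArg (fun T => T v) (h1.unique h2)
  have h4 : ‖r x‖ = 1 := h.self_of_nhds
  simp [hv', h4] at h3

/-- There is no `C¹` retraction of the closed unit ball onto its boundary sphere. -/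
theorem not_exists_contDiff_retraction {r : E → E} {U : Set E} (hU : IsOpen U)
    (hBU : closedBall 0 1 ⊆ U) (hr : ContDiffOn ℝ 1 r U) (h1 : ∀ x ∈ closedBall 0 1, ‖r x‖ = 1)
    (hid : ∀ x ∈ sphere 0 1, r x = x) : False := by
  let _ : MeasurableSpace E := borel E
  have _ : BorelSpace E := ⟨rfl⟩
  have hdiff : ∀ x ∈ closedBall (0 : E) 1, HasFDerivAt r (fderiv ℝ r x) x := fun x hx =>
    ((hr.differentiableOn one_ne_zero).differentiableAt (hU.mem_nhds (hBU hx))).hasFDerivAt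
  have hcont : ContinuousOn (fderiv ℝ r) (closedBall (0 : E) 1) :=
    (hr.continuousOn_fderiv_of_isOpen hU le_rfl).mono hBU
  have hK : IsCompact (closedBall (0 : E) 1) := isCompact_closedBall 0 1
  let A : E → E →L[ℝ] E := fun x => fderiv ℝ r x - 1
  have hA : ContinuousOn A (closedBall (0 : E) 1) := hcont.sub continuousOn_const
  obtain ⟨L, hL⟩ := hK.exists_bound_of_continuousOn hA
  have hL0 : 0 ≤ L := (norm_nonneg _).trans (hL 0 (by simp))
  let g : E → E := fun x => r x - x
  have hgder : ∀ x ∈ closedBall (0 : E) 1, HasFDerivAt g (A x) x := fun x hx =>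
    (hdiff x hx).sub (hasFDerivAt_id x)
  have hglip : ∀ x ∈ closedBall (0 : E) 1, ∀ y ∈ closedBall (0 : E) 1,
      ‖g x - g y‖ ≤ L * ‖x - y‖ := fun x hx y hy =>
    (convex_closedBall (0 : E) 1).norm_image_sub_le_of_norm_hasFDerivWithin_le
      (fun z hz => (hgder z hz).hasFDerivWithinAt) hL hy hx
  have hg0 : ∀ x ∈ sphere (0 : E) 1, g x = 0 := fun x hx => sub_eq_zero.mpr (hid x hx)
  let G : E → E := (closedBall (0 : E) 1).indicator g
  have hG := norm_indicator_closedBall_sub_le hL0 hglip hg0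
  have hGin : ∀ x ∈ ball (0 : E) 1, G x = g x := fun x hx =>
    indicator_of_mem (ball_subset_closedBall hx) g
  have hGout : ∀ x ∉ ball (0 : E) 1, G x = 0 := by
    intro x hx
    by_cases hx' : x ∈ closedBall (0 : E) 1
    · refine (indicator_of_mem hx' g).trans (hg0 x ?_)
      simp only [mem_ball, mem_closedBall, mem_sphere] at *
      exact le_antisymm hx' (not_lt.mp hx)
    · exact indicator_of_notMem hx' g
  -- the volume of the image of the ball under the interpolation towards `r`
  have hvol : ∀ t : ℝ, 0 < t → t < 1 → t * L < 1 →
      (∀ x ∈ closedBall (0 : E) 1, 0 < (1 + t • A x).det) →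
      ∫ x in ball (0 : E) 1, (1 + t • A x).det = (volume (ball (0 : E) 1)).toReal := by
    intro t ht0 ht1 htL hpos
    let f : E → E := fun x => x + t • G x
    have happ : ApproximatesLinearOn f ((ContinuousLinearEquiv.refl ℝ E : E ≃L[ℝ] E) : E →L[ℝ] E)
        univ (t * L).toNNReal := by
      rw [ApproximatesLinearOn.approximatesLinearOn_iff_lipschitzOnWith]
      refine LipschitzOnWith.of_dist_le_mul fun x _ y _ => ?_
      simp only [f, dist_eq_norm, Real.coe_toNNReal _ (mul_nonneg ht0.le hL0), Pi.sub_apply,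
        ContinuousLinearEquiv.coe_coe,
        ContinuousLinearEquiv.coe_refl', id, add_sub_cancel_left]
      rw [← smul_sub, norm_smul, Real.norm_of_nonneg ht0.le, mul_assoc]
      exact mul_le_mul_of_nonneg_left (hG x y) ht0.le
    have hc : Subsingleton E ∨ (t * L).toNNReal <
        ‖((ContinuousLinearEquiv.refl ℝ E).symm : E →L[ℝ] E)‖₊⁻¹ := by
      rcases subsingleton_or_nontrivial E with h | h
      · exact Or.inl h
      · right
        have : ‖((ContinuousLinearEquiv.refl ℝ E).symm : E →L[ℝ] E)‖₊ = 1 := by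
          rw [ContinuousLinearEquiv.refl_symm, ContinuousLinearEquiv.coe_refl]
          exact ContinuousLinearMap.nnnorm_id
        rw [this, inv_one]
        exact Real.toNNReal_lt_one.mpr htL
    have hinj : InjOn f (ball 0 1) := (happ.injOn hc).mono (subset_univ _)
    have hsurj : Function.Surjective f := happ.surjective hc
    have himg : f '' ball (0 : E) 1 = ball (0 : E) 1 := by
      apply Set.Subset.antisymm
      · rintro _ ⟨x, hx, rfl⟩
        have hr1 := h1 x (ball_subset_closedBall hx)
        have : f x = (1 - t) • x + t • r x := by
          simp only [f, hGin x hx, g]; module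
        rw [mem_ball_zero_iff] at *
        rw [this]
        calc _ ≤ ‖(1 - t) • x‖ + ‖t • r x‖ := norm_add_le _ _
          _ = (1 - t) * ‖x‖ + t := by
            rw [norm_smul, norm_smul, hr1, Real.norm_of_nonneg ht0.le,
              Real.norm_of_nonneg (by linarith), mul_one]
          _ < 1 := by nlinarith
      · intro y hy
        obtain ⟨x, rfl⟩ := hsurj y
        by_cases hx : x ∈ ball (0 : E) 1
        · exact ⟨x, hx, rfl⟩
        · have : f x = x := by simp [f, hGout x hx]
          rw [this] at hy
          exact absurd hy hx
    have hder : ∀ x ∈ ball (0 : E) 1, HasFDerivWithinAt f (1 + t • A x) (ball 0 1) x := by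
      intro x hx
      have : HasFDerivAt (fun x => x + t • g x) (1 + t • A x) x :=
        (hasFDerivAt_id x).add ((hgder x (ball_subset_closedBall hx)).const_smul t)
      refine this.hasFDerivWithinAt.congr (fun y hy => ?_) ?_
      · simp only [f, hGin y hy]
      · simp only [f, hGin x hx]
    have := integral_image_eq_integral_abs_det_fderiv_smul volume measurableSet_ball hder hinj
      (fun _ => (1 : ℝ))
    rw [himg] at this
    simp only [smul_eq_mul, mul_one, integral_const, MeasurableSet.univ, measureReal_restrict_apply,
      Set.univ_inter] at this
    rw [measureReal_def] at this
    rw [this]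
    refine setIntegral_congr_fun measurableSet_ball fun x hx => ?_
    exact (abs_of_pos (hpos x (ball_subset_closedBall hx))).symm
  have hdetc : Continuous (fun B : E →L[ℝ] E => B.det) := ContinuousLinearMap.continuous_det
  have hev : ∀ᶠ t in 𝓝 (0 : ℝ), ∀ x ∈ closedBall (0 : E) 1, 0 < (1 + t • A x).det := by
    obtain ⟨π, hπc, hπm, hπid⟩ := exists_continuous_projection_closedBall (E := E)
    have hAπ : Continuous fun x => A (π x) := hA.comp_continuous hπc hπm
    have := hK.eventually_forall_of_forall_eventually (x₀ := (0 : ℝ))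
      (P := fun t x => 0 < (1 + t • A (π x)).det) (fun y _ => by
        have hc : Continuous fun z : ℝ × E => (1 + z.1 • A (π z.2)).det :=
          hdetc.comp (continuous_const.add (continuous_fst.smul (hAπ.comp continuous_snd)))
        refine (hc.tendsto (0, y)).eventually (lt_mem_nhds ?_)
        simp [ContinuousLinearMap.det])
    filter_upwards [this] with t ht x hx
    simpa only [hπid x hx] using ht x hx
  have hev' : ∀ᶠ t in 𝓝[>] (0 : ℝ), 0 < t ∧ t < 1 ∧ t * L < 1 ∧
      ∀ x ∈ closedBall (0 : E) 1, 0 < (1 + t • A x).det := by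
    have h2 : ∀ᶠ t in 𝓝 (0 : ℝ), t * L < 1 := by
      have : Tendsto (fun t : ℝ => t * L) (𝓝 0) (𝓝 0) := by
        simpa using (continuous_mul_const L).tendsto 0
      exact this.eventually (gt_mem_nhds one_pos)
    filter_upwards [self_mem_nhdsWithin, nhdsWithin_le_nhds (gt_mem_nhds one_pos),
      nhdsWithin_le_nhds h2, nhdsWithin_le_nhds hev] with t a b c d using ⟨a, b, c, d⟩
  obtain ⟨δ, hδ, hδ'⟩ := (mem_nhdsGT_iff_exists_Ioo_subset.mp hev')
  obtain ⟨s, hsub, hs⟩ := (Set.Ioo_infinite (show (0 : ℝ) < δ from hδ)).exists_subset_card_eq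
    (Module.finrank ℝ E + 1)
  obtain ⟨w, hw1, hw⟩ := exists_weights_eval_one_eq_sum hs
  have hint : ∀ t : ℝ, IntegrableOn (fun x => (1 + t • A x).det) (ball (0 : E) 1) := by
    intro t
    refine (ContinuousOn.integrableOn_compact hK ?_).mono_set ball_subset_closedBall
    exact hdetc.comp_continuousOn (continuousOn_const.add (hA.const_smul t))
  have hone : ∀ x ∈ ball (0 : E) 1, ∑ t ∈ s, w t * (1 + t • A x).det = 0 := by
    intro x hx
    obtain ⟨P, hP, hPe⟩ := exists_polynomial_eval_eq_det_one_add_smul (A x)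
    have := hw P hP
    simp only [hPe] at this
    rw [← this]
    have h3 : 1 + (1 : ℝ) • A x = fderiv ℝ r x := by simp [A]
    rw [h3]
    refine det_eq_zero_of_norm_eq_one (hdiff x (ball_subset_closedBall hx)).differentiableAt ?_
    filter_upwards [isOpen_ball.mem_nhds hx] with y hy using h1 y (ball_subset_closedBall hy)
  have h5 : ∫ x in ball (0 : E) 1, ∑ t ∈ s, w t * (1 + t • A x).det = 0 := by
    rw [setIntegral_congr_fun measurableSet_ball hone]; simp
  rw [integral_finsetSum _ fun t _ => (hint t).const_mul (w t)] at h5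
  have h6 : ∀ t ∈ s, ∫ x in ball (0 : E) 1, w t * (1 + t • A x).det =
      w t * (volume (ball (0 : E) 1)).toReal := by
    intro t ht
    obtain ⟨a, b, c, d⟩ := hδ' (hsub ht)
    rw [integral_const_mul, hvol t a b c d]
  rw [Finset.sum_congr rfl h6, ← Finset.sum_mul, hw1, one_mul] at h5
  exact (ENNReal.toReal_pos (measure_ball_pos _ _ one_pos).ne' measure_ball_lt_top.ne).ne' h5

/-- A `C¹` vector field on the closed unit ball pointing outwards on the sphere has a zero. -/
theorem exists_zero_of_inner_pos {w : E → E} (hw : ContDiff ℝ 1 w)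
    (hout : ∀ x ∈ sphere (0 : E) 1, 0 < inner ℝ x (w x)) :
    ∃ x ∈ closedBall (0 : E) 1, w x = 0 := by
  by_contra! hne
  let D : E → ℝ := fun x => inner ℝ x (w x) ^ 2 + ‖w x‖ ^ 2 * (1 - ‖x‖ ^ 2)
  let s : E → ℝ := fun x => (-inner ℝ x (w x) + √(D x)) / ‖w x‖ ^ 2
  let r : E → E := fun x => x + s x • w x
  have hin : ContDiff ℝ 1 fun x : E => inner ℝ x (w x) := contDiff_id.inner ℝ hw
  have hD : ContDiff ℝ 1 D :=
    (hin.pow 2).add ((hw.norm_sq ℝ).mul (contDiff_const.sub (contDiff_id.norm_sq ℝ)))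
  have hDpos : ∀ x ∈ closedBall (0 : E) 1, 0 < D x := by
    intro x hx
    have hwx : 0 < ‖w x‖ := norm_pos_iff.mpr (hne x hx)
    have hx1 : ‖x‖ ≤ 1 := mem_closedBall_zero_iff.mp hx
    rcases hx1.lt_or_eq with h | h
    · have : 0 < 1 - ‖x‖ ^ 2 := by nlinarith [norm_nonneg x]
      exact add_pos_of_nonneg_of_pos (sq_nonneg _) (by positivity)
    · have := hout x (by simpa using h)
      simp only [D, h]
      nlinarith
  refine not_exists_contDiff_retraction (r := r) (U := {x | w x ≠ 0 ∧ 0 < D x})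
    ((isOpen_ne.preimage hw.continuous).inter (isOpen_Ioi.preimage hD.continuous))
    (fun x hx => ⟨hne x hx, hDpos x hx⟩) ?_ ?_ ?_
  · refine contDiffOn_id.add (ContDiffOn.smul (ContDiffOn.div ?_ ?_ ?_) hw.contDiffOn)
    · exact hin.neg.contDiffOn.add (hD.contDiffOn.sqrt fun x hx => hx.2.ne')
    · exact (hw.norm_sq ℝ).contDiffOn
    · intro x hx
      have := norm_pos_iff.mpr hx.1
      positivity
  · intro x hx
    have hwx : 0 < ‖w x‖ := norm_pos_iff.mpr (hne x hx)
    have h2 : ‖r x‖ ^ 2 = 1 := by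
      simp only [r]
      rw [norm_add_sq_real, inner_smul_right, norm_smul, mul_pow, Real.norm_eq_abs, sq_abs]
      have hs : s x * ‖w x‖ ^ 2 = -inner ℝ x (w x) + √(D x) := by
        simp only [s]; field_simp
      have hsq := Real.sq_sqrt (hDpos x hx).le
      have h3 : (s x * ‖w x‖ ^ 2 + inner ℝ x (w x)) ^ 2 = D x := by
        rw [hs, show (-inner ℝ x (w x) + √(D x) + inner ℝ x (w x)) ^ 2 = √(D x) ^ 2 by ring, hsq]
      simp only [D] at h3
      have h4 : ‖w x‖ ^ 2 * (‖x‖ ^ 2 + 2 * (s x * inner ℝ x (w x)) + s x ^ 2 * ‖w x‖ ^ 2)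
          = ‖w x‖ ^ 2 * 1 := by linarith
      exact mul_left_cancel₀ (by positivity) h4
    exact (pow_eq_one_iff_of_nonneg (norm_nonneg _) two_ne_zero).mp h2
  · intro x hx
    have h0 : ‖x‖ = 1 := by simpa using hx
    have : s x = 0 := by
      simp only [s, D, h0, one_pow, sub_self, mul_zero, add_zero]
      rw [Real.sqrt_sq (hout x hx).le]; simp
    simp [r, this]

/-- A form of Brouwer's fixed point theorem. -/
theorem exists_zero_of_norm_sub_le {h : E → E} (hc : Continuous h)
    (hh : ∀ x ∈ closedBall (0 : E) 1, ‖h x - x‖ ≤ 1) : ∃ x ∈ closedBall (0 : E) 1, h x = 0 := by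
  by_contra! hne
  obtain ⟨δ, hδ, hδh⟩ := (isCompact_closedBall (0 : E) 1).exists_forall_le'
    (f := fun x => ‖h x‖) hc.norm.continuousOn (a := 0) fun x hx => norm_pos_iff.mpr (hne x hx)
  obtain ⟨g, hg, hgh, -⟩ := hc.exists_contDiff_approx 1 (ε := fun _ => δ / 4) continuous_const
    (fun _ => by positivity)
  simp only [dist_eq_norm] at hgh
  obtain ⟨x, hx, hx0⟩ := exists_zero_of_inner_pos (w := fun x => (δ / 4) • x + g x)
    ((contDiff_id.const_smul _).add hg) (by
      intro x hx
      have h0 : ‖x‖ = 1 := by simpa using hx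
      have h1 : ‖g x - x‖ < 1 + δ / 4 := by
        calc _ = ‖(g x - h x) + (h x - x)‖ := by congr 1; abel
          _ ≤ ‖g x - h x‖ + ‖h x - x‖ := norm_add_le _ _
          _ < _ := by linarith [hgh x, hh x (sphere_subset_closedBall hx)]
      have h2 := neg_le_of_abs_le (abs_real_inner_le_norm x (g x - x))
      have h3 : (δ / 4) • x + g x = (1 + δ / 4) • x + (g x - x) := by module
      rw [h3, inner_add_right, inner_smul_right, real_inner_self_eq_norm_sq, h0]
      rw [h0] at h2
      linarith)
  have h1 := hδh x hx
  have h2 : h x = -(δ / 4) • x - (g x - h x) := by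
    have : g x = -(δ / 4) • x := by rw [neg_smul]; exact eq_neg_of_add_eq_zero_right hx0
    rw [this]; abel
  have h3 : ‖h x‖ ≤ δ / 4 * 1 + δ / 4 := by
    rw [h2]
    refine (norm_sub_le _ _).trans (add_le_add ?_ (hgh x).le)
    rw [norm_smul, norm_neg, Real.norm_of_nonneg (by positivity)]
    exact mul_le_mul_of_nonneg_left (mem_closedBall_zero_iff.mp hx) (by positivity)
  linarith

theorem image_closedBall_mem_nhds {f : E → E} (hf : ContinuousOn f (closedBall 0 1))
    (hinj : InjOn f (closedBall 0 1)) : f '' closedBall 0 1 ∈ 𝓝 (f 0) := by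
  by_contra hK
  let _ : MeasurableSpace E := borel E
  have _ : BorelSpace E := ⟨rfl⟩
  have hB : IsCompact (closedBall (0 : E) 1) := isCompact_closedBall 0 1
  have _ : CompactSpace (closedBall (0 : E) 1) := isCompact_iff_compactSpace.mp hB
  set K := f '' closedBall (0 : E) 1 with hKdef
  have hKc : IsCompact K := hB.image_of_continuousOn hf
  have he : IsClosedEmbedding ((closedBall (0 : E) 1).domRestrict f) :=
    (continuousOn_iff_continuous_domRestrict.mp hf).isClosedEmbedding hinj.injective
  obtain ⟨G, hG⟩ := ContinuousMap.exists_extension he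
    (⟨Subtype.val, continuous_subtype_val⟩ : C(closedBall (0 : E) 1, E))
  have hGf : ∀ x ∈ closedBall (0 : E) 1, G (f x) = x := fun x hx =>
    congrArg (fun F => F ⟨x, hx⟩) hG
  have h0 : (0 : E) ∈ closedBall (0 : E) 1 := by simp
  have hG0 : G (f 0) = 0 := hGf 0 h0
  obtain ⟨ε, hε, hGε⟩ := Metric.continuousAt_iff.mp (G.continuous.continuousAt (x := f 0))
    (1 / 10) (by norm_num)
  simp only [hG0, dist_zero_right] at hGε
  obtain ⟨c, hc, hcK⟩ : ∃ c ∈ ball (f 0) (ε / 3), c ∉ K := by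
    by_contra! h
    exact hK (mem_of_superset (ball_mem_nhds _ (by positivity)) h)
  set η := ε / 3 with hη
  have hη0 : 0 < η := by positivity
  have hsmall : ∀ y, ‖y - c‖ ≤ η → ‖G y‖ < 1 / 10 := by
    intro y hy
    refine hGε ?_
    have := dist_triangle y c (f 0)
    rw [dist_eq_norm y c] at this
    have := mem_ball.mp hc
    linarith
  obtain ⟨δ, hδ, hδG⟩ := (hKc.inter_right
    (isClosed_le continuous_const (by fun_prop : Continuous fun y : E => ‖y - c‖)
      : IsClosed {y | η ≤ ‖y - c‖})).exists_forall_le' (f := fun y => ‖G y‖)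
    G.continuous.norm.continuousOn (a := 0) (by
      rintro _ ⟨⟨x, hx, rfl⟩, hy⟩
      refine norm_pos_iff.mpr fun hz => ?_
      rw [hGf x hx] at hz
      subst hz
      rw [mem_ball, dist_comm, dist_eq_norm] at hc
      exact absurd hy (not_le.mpr hc))
  set δ' := min δ (1 / 10) with hδ'
  have hδ'0 : 0 < δ' := lt_min hδ (by norm_num)
  obtain ⟨P₀, hP₀, hP₀G, -⟩ := G.continuous.exists_contDiff_approx 1 (ε := fun _ => δ' / 2)
    continuous_const (fun _ => by positivity)
  have hnull : volume (P₀ '' sphere c η) = 0 :=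
    addHaar_image_eq_zero_of_differentiableOn_of_addHaar_eq_zero volume
      (hP₀.differentiable one_ne_zero).differentiableOn
      (Measure.addHaar_sphere_of_ne_zero volume c hη0.ne')
  obtain ⟨p, hp, hpn⟩ : ∃ p ∈ ball (0 : E) (δ' / 2), p ∉ P₀ '' sphere c η := by
    by_contra! h
    exact (measure_ball_pos volume (0 : E) (by positivity : 0 < δ' / 2)).ne'
      (measure_mono_null h hnull)
  let P : E → E := fun y => P₀ y - p
  have hPG : ∀ y, ‖P y - G y‖ < δ' := by
    intro y
    have h1 := hP₀G y
    rw [dist_eq_norm] at h1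
    have h2 := mem_ball_zero_iff.mp hp
    calc ‖P y - G y‖ = ‖(P₀ y - G y) - p‖ := by simp only [P]; congr 1; abel
      _ ≤ ‖P₀ y - G y‖ + ‖p‖ := norm_sub_le _ _
      _ < δ' := by linarith
  let Φ : E → E := fun y => c + max (η / ‖y - c‖) 1 • (y - c)
  have hne : ∀ y ∈ K, y - c ≠ 0 := fun y hy h => hcK (sub_eq_zero.mp h ▸ hy)
  have hΦc : ContinuousOn Φ K := by
    refine continuousOn_const.add (ContinuousOn.smul (ContinuousOn.sup ?_ continuousOn_const)
      (by fun_prop))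
    exact continuousOn_const.div (by fun_prop) fun y hy => norm_ne_zero_iff.mpr (hne y hy)
  have hΦ1 : ∀ y ∈ K, η ≤ ‖y - c‖ → Φ y = y := by
    intro y hy h
    have : η / ‖y - c‖ ≤ 1 := div_le_one_of_le₀ h (norm_nonneg _)
    simp [Φ, max_eq_right this]
  have hΦ2 : ∀ y ∈ K, ‖y - c‖ ≤ η → ‖Φ y - c‖ = η := by
    intro y hy h
    have hpos : 0 < ‖y - c‖ := norm_pos_iff.mpr (hne y hy)
    have : 1 ≤ η / ‖y - c‖ := (one_le_div hpos).mpr h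
    simp only [Φ, max_eq_left this, add_sub_cancel_left]
    rw [norm_smul, Real.norm_of_nonneg (by positivity)]
    field_simp
  obtain ⟨π, hπc, hπm, hπid⟩ := exists_continuous_projection_closedBall (E := E)
  have hfπ : Continuous fun x => f (π x) := hf.comp_continuous hπc hπm
  have hmem : ∀ x, f (π x) ∈ K := fun x => mem_image_of_mem f (hπm x)
  have hcont : Continuous fun x => P (Φ (f (π x))) :=
    (hP₀.continuous.sub continuous_const).comp (hΦc.comp_continuous hfπ hmem)
  obtain ⟨x, hx, hx0⟩ := exists_zero_of_norm_sub_le hcont (by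
    intro x hx
    rw [hπid x hx]
    have hy : f x ∈ K := mem_image_of_mem f hx
    have hd1 : δ' ≤ 1 / 10 := min_le_right _ _
    rcases le_total η ‖f x - c‖ with h | h
    · have := hPG (f x)
      rw [hGf x hx] at this
      rw [hΦ1 _ hy h]
      linarith
    · have h1 := hPG (Φ (f x))
      have h2 := hsmall _ (hΦ2 _ hy h).le
      have h3 := hsmall _ h
      rw [hGf x hx] at h3
      calc ‖P (Φ (f x)) - x‖ = ‖(P (Φ (f x)) - G (Φ (f x))) + G (Φ (f x)) - x‖ := by
            congr 1; abel
        _ ≤ ‖P (Φ (f x)) - G (Φ (f x))‖ + ‖G (Φ (f x))‖ + ‖x‖ :=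
            (norm_sub_le _ _).trans (by gcongr; exact norm_add_le _ _)
        _ ≤ 1 := by linarith)
  rw [hπid x hx] at hx0
  have hy : f x ∈ K := mem_image_of_mem f hx
  rcases le_total η ‖f x - c‖ with h | h
  · rw [hΦ1 _ hy h] at hx0
    have h1 := hPG (f x)
    rw [hx0, zero_sub, norm_neg] at h1
    have h2 : δ ≤ ‖G (f x)‖ := hδG _ ⟨hy, h⟩
    linarith [min_le_left δ (1 / 10)]
  · refine hpn ⟨Φ (f x), ?_, sub_eq_zero.mp hx0⟩
    rw [mem_sphere, dist_eq_norm]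
    exact hΦ2 _ hy h

/-- **Invariance of domain**. -/
theorem isOpen_image_of_injOn {U : Set E} (hU : IsOpen U) {f : E → E} (hf : ContinuousOn f U)
    (hinj : InjOn f U) : IsOpen (f '' U) := by
  rw [isOpen_iff_mem_nhds]
  rintro _ ⟨x, hx, rfl⟩
  obtain ⟨ε, hε, hεU⟩ := Metric.nhds_basis_closedBall.mem_iff.mp (hU.mem_nhds hx)
  have hmaps : MapsTo (fun y : E => x + ε • y) (closedBall 0 1) U := by
    intro y hy
    refine hεU ?_
    rw [mem_closedBall, dist_eq_norm, add_sub_cancel_left, norm_smul, Real.norm_of_nonneg hε.le]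
    exact mul_le_of_le_one_right hε.le (mem_closedBall_zero_iff.mp hy)
  have h := image_closedBall_mem_nhds (f := fun y => f (x + ε • y))
    (hf.comp (by fun_prop) hmaps) (by
      intro a ha b hb hab
      have := hinj (hmaps ha) (hmaps hb) hab
      exact smul_right_injective E hε.ne' (add_left_cancel this))
  simp only [smul_zero, add_zero] at h
  refine mem_of_superset h ?_
  rintro _ ⟨y, hy, rfl⟩
  exact ⟨_, hmaps hy, rfl⟩

end Brouwer

section Charted

variable {E F M : Type*} [NormedAddCommGroup E] [NormedSpace ℝ E] [FiniteDimensional ℝ E]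
  [NormedAddCommGroup F] [NormedSpace ℝ F] [FiniteDimensional ℝ F]

/-- Invariance of domain for maps into a space of at most the dimension of the source. -/
theorem isOpen_image_of_finrank_le (hEF : Module.finrank ℝ F ≤ Module.finrank ℝ E) {U : Set E}
    (hU : IsOpen U) {f : E → F} (hf : ContinuousOn f U) (hinj : Set.InjOn f U) :
    IsOpen (f '' U) := by
  let E' := EuclideanSpace ℝ (Fin (Module.finrank ℝ E))
  have e : E ≃L[ℝ] E' := ContinuousLinearEquiv.ofFinrankEq (by simp [E'])
  obtain ⟨i, hi⟩ := finrank_le_iff_exists_linearMap.mp hEF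
  have hic : Continuous i := i.continuous_of_finiteDimensional
  have h := isOpen_image_of_injOn (U := e.symm ⁻¹' U) (hU.preimage e.symm.continuous)
    (f := fun x => e (i (f (e.symm x))))
    (e.continuous.comp_continuousOn (hic.comp_continuousOn
      (hf.comp e.symm.continuous.continuousOn fun x hx => hx))) (by
      intro x hx y hy hxy
      exact e.symm.injective (hinj hx hy (hi (e.injective hxy))))
  have h2 : f '' U = (fun y => e (i y)) ⁻¹'
      ((fun x => e (i (f (e.symm x)))) '' (e.symm ⁻¹' U)) := by
    ext y
    constructor
    · rintro ⟨x, hx, rfl⟩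
      exact ⟨e x, by simpa using hx, by simp⟩
    · rintro ⟨x, hx, hxy⟩
      exact ⟨e.symm x, hx, hi (e.injective hxy)⟩
  rw [h2]
  exact h.preimage (e.continuous.comp hic)

variable [TopologicalSpace M] [ChartedSpace E M]

theorem ChartedSpace.isOpen_image_of_finrank_le
    (hEF : Module.finrank ℝ F ≤ Module.finrank ℝ E) {W : Set M} (hW : IsOpen W) {g : M → F}
    (hg : ContinuousOn g W) (hinj : Set.InjOn g W) : IsOpen (g '' W) := by
  rw [isOpen_iff_mem_nhds]
  rintro _ ⟨x, hx, rfl⟩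
  let c := chartAt E x
  have hO : IsOpen (c.target ∩ c.symm ⁻¹' W) := c.symm.isOpen_inter_preimage hW
  have h := _root_.isOpen_image_of_finrank_le hEF hO (f := g ∘ c.symm)
    (hg.comp (c.symm.continuousOn.mono Set.inter_subset_left) fun y hy => hy.2) (by
      intro y hy z hz hyz
      exact c.symm.injOn hy.1 hz.1 (hinj hy.2 hz.2 hyz))
  have hxc : x ∈ c.source := mem_chart_source E x
  refine Filter.mem_of_superset (h.mem_nhds ⟨c x, ⟨c.map_source hxc, ?_⟩, ?_⟩) ?_
  · simpa [c.left_inv hxc] using hx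
  · simp [c.left_inv hxc]
  · rintro _ ⟨y, hy, rfl⟩
    exact ⟨_, hy.2, rfl⟩

theorem ChartedSpace.isOpen_image_of_le_finrank
    (hEF : Module.finrank ℝ E ≤ Module.finrank ℝ F) {V : Set F} (hV : IsOpen V) {f : F → M}
    (hf : ContinuousOn f V) (hinj : Set.InjOn f V) : IsOpen (f '' V) := by
  rw [isOpen_iff_mem_nhds]
  rintro _ ⟨x, hx, rfl⟩
  let c := chartAt E (f x)
  have hO : IsOpen (V ∩ f ⁻¹' c.source) := hf.isOpen_inter_preimage hV c.open_source
  have h := _root_.isOpen_image_of_finrank_le hEF hO (f := c ∘ f)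
    (c.continuousOn.comp (hf.mono Set.inter_subset_left) fun y hy => hy.2) (by
      intro y hy z hz hyz
      exact hinj hy.1 hz.1 (c.injOn hy.2 hz.2 hyz))
  have hxc : f x ∈ c.source := mem_chart_source E (f x)
  refine Filter.mem_of_superset ((c.isOpen_inter_preimage h).mem_nhds
    ⟨hxc, x, ⟨hx, hxc⟩, rfl⟩) ?_
  rintro y ⟨hy, z, hz, hzy⟩
  exact ⟨z, hz.1, c.injOn hz.2 hy hzy⟩

end Charted

section Realization

variable {N n : ℕ} {Δ : Finset (Finset (Fin N))}

/-- Charts pulled back along a homeomorphism. -/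
@[reducible]
noncomputable def Homeomorph.pullbackChartedSpace (H : Type*) {M M' : Type*} [TopologicalSpace H]
    [TopologicalSpace M] [TopologicalSpace M'] [ChartedSpace H M'] (φ : M ≃ₜ M') :
    ChartedSpace H M where
  atlas := (fun c => φ.toOpenPartialHomeomorph.trans c) '' atlas H M'
  chartAt x := φ.toOpenPartialHomeomorph.trans (chartAt H (φ x))
  mem_chart_source x := by simp
  chart_mem_atlas x := ⟨_, chart_mem_atlas H (φ x), rfl⟩

/-- The barycenter of the face `R`. -/
noncomputable def barycenter (R : Finset (Fin N)) : Fin N → ℝ :=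
  fun a => if a ∈ R then (#R : ℝ)⁻¹ else 0

theorem barycenter_nonneg (R : Finset (Fin N)) (a : Fin N) : 0 ≤ barycenter R a := by
  unfold barycenter; split_ifs <;> positivity

theorem sum_barycenter {R : Finset (Fin N)} (hR : R.Nonempty) : ∑ a, barycenter R a = 1 := by
  have : (#R : ℝ) ≠ 0 := by exact_mod_cast hR.card_pos.ne'
  simp [barycenter, Finset.sum_ite_mem, this]

theorem barycenter_mem_realize {R : Finset (Fin N)} (hR : R.Nonempty) (hRΔ : R ∈ Δ) :
    barycenter R ∈ realize Δ := by
  refine ⟨R, hRΔ, barycenter_nonneg R, fun v hv => ?_, sum_barycenter hR⟩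
  by_contra h
  simp [barycenter, h] at hv

theorem insert_mem_of_mem_realize (hdown : ∀ F ∈ Δ, ∀ G ⊆ F, G ∈ Δ) {R : Finset (Fin N)}
    {x : Fin N → ℝ} (hx : x ∈ realize Δ) (hR : ∀ r ∈ R, x r ≠ 0) {w : Fin N} (hw : x w ≠ 0) :
    insert w R ∈ Δ := by
  obtain ⟨F, hF, -, hsupp, -⟩ := hx
  exact hdown F hF _ (Finset.insert_subset (hsupp w hw) fun r hr => hsupp r (hR r hr))

theorem exists_ne_insert_mem_of_chartedSpace
    [ChartedSpace (EuclideanSpace ℝ (Fin n)) (realize Δ)]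
    (hdown : ∀ F ∈ Δ, ∀ G ⊆ F, G ∈ Δ) {R : Finset (Fin N)} (hR : R ∈ Δ) (hne : R.Nonempty)
    (hcard : #R ≤ n) :
    ∃ u v, u ≠ v ∧ u ∉ R ∧ v ∉ R ∧ insert u R ∈ Δ ∧ insert v R ∈ Δ := by
  by_contra! hcon
  obtain ⟨r₀, hr₀⟩ := hne
  let W : Set (realize Δ) := {x | ∀ r ∈ R, 0 < x.1 r}
  have hW : IsOpen W := by
    have : W = ⋂ r ∈ R, {x : realize Δ | 0 < x.1 r} := by ext; simp [W]
    rw [this]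
    exact isOpen_biInter_finset fun r _ => isOpen_lt continuous_const
      ((continuous_apply r).comp continuous_subtype_val)
  let g : realize Δ → R → ℝ := fun x r => if r.1 = r₀ then ∑ w ∈ Rᶜ, x.1 w else x.1 r
  have hg : Continuous g := by
    refine continuous_pi fun r => ?_
    by_cases h : r.1 = r₀
    · simp only [g, h, if_true]
      exact continuous_finsetSum _ fun w _ => (continuous_apply w).comp continuous_subtype_val
    · simp only [g, h, if_false]
      exact (continuous_apply _).comp continuous_subtype_val
  have hout : ∀ x ∈ W, ∀ w ∉ R, x.1 w ≠ 0 → insert w R ∈ Δ := fun x hx w _ hw' =>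
    insert_mem_of_mem_realize hdown x.2 (fun r hr => (hx r hr).ne') hw'
  have hinj : Set.InjOn g W := by
    intro x hx y hy hxy
    have hs : ∑ w ∈ Rᶜ, x.1 w = ∑ w ∈ Rᶜ, y.1 w := by simpa [g] using congrFun hxy ⟨r₀, hr₀⟩
    have h1 : ∀ w ∉ R, x.1 w = y.1 w := by
      intro w hw
      by_contra hne
      have hwR : insert w R ∈ Δ := by
        by_cases h : x.1 w = 0
        · exact hout y hy w hw fun h' => hne (h.trans h'.symm)
        · exact hout x hx w hw h
      have hz : ∀ z ∈ W, ∑ a ∈ Rᶜ, z.1 a = z.1 w := by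
        intro z hz
        refine Finset.sum_eq_single_of_mem w (by simpa using hw) fun a ha haw => ?_
        by_contra h
        exact hcon a w haw (by simpa using ha) hw (hout z hz a (by simpa using ha) h) hwR
      exact hne (by rw [← hz x hx, ← hz y hy, hs])
    have h2 : ∀ r ∈ R, r ≠ r₀ → x.1 r = y.1 r := by
      intro r hr hr'
      simpa [g, hr'] using congrFun hxy ⟨r, hr⟩
    have h3 : ∀ a, a ≠ r₀ → x.1 a = y.1 a := fun a ha => by
      by_cases h : a ∈ R
      · exact h2 a h ha
      · exact h1 a h
    ext a
    by_cases ha : a = r₀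
    · subst ha
      obtain ⟨-, -, -, -, hx1⟩ := x.2
      obtain ⟨-, -, -, -, hy1⟩ := y.2
      rw [← Finset.add_sum_erase _ _ (mem_univ a)] at hx1 hy1
      have : ∑ b ∈ univ.erase a, x.1 b = ∑ b ∈ univ.erase a, y.1 b :=
        Finset.sum_congr rfl fun b hb => h3 b (Finset.ne_of_mem_erase hb)
      linarith
    · exact h3 a ha
  have hopen := ChartedSpace.isOpen_image_of_finrank_le (E := EuclideanSpace ℝ (Fin n))
    (by simpa using hcard) hW hg.continuousOn hinj
  have hopen' := isOpenMap_eval (⟨r₀, hr₀⟩ : R) _ hopen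
  have h0 : (0 : ℝ) ∈ Function.eval (⟨r₀, hr₀⟩ : R) '' (g '' W) := by
    refine ⟨_, ⟨⟨barycenter R, barycenter_mem_realize ⟨r₀, hr₀⟩ hR⟩, ?_, rfl⟩, ?_⟩
    · intro r hr
      have : 0 < #R := card_pos.mpr ⟨r, hr⟩
      simp only [barycenter, hr, if_true]
      positivity
    · simp only [Function.eval, g, if_true]
      refine Finset.sum_eq_zero fun w hw => ?_
      simp [barycenter, Finset.mem_compl.mp hw]
  have hsub : Function.eval (⟨r₀, hr₀⟩ : R) '' (g '' W) ⊆ Set.Ici 0 := by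
    rintro _ ⟨_, ⟨x, -, rfl⟩, rfl⟩
    obtain ⟨-, -, hx, -, -⟩ := x.2
    simp only [Function.eval, g, if_true, Set.mem_Ici]
    exact Finset.sum_nonneg fun w _ => hx w
  have := interior_maximal hsub hopen' h0
  rw [interior_Ici] at this
  exact lt_irrefl (0 : ℝ) this

theorem not_three_insert_mem_of_chartedSpace
    [ChartedSpace (EuclideanSpace ℝ (Fin n)) (realize Δ)]
    {R : Finset (Fin N)} (hne : R.Nonempty) (hcard : #R = n) {u v w : Fin N}
    (huv : u ≠ v) (huw : u ≠ w) (hvw : v ≠ w) (hu : u ∉ R) (hv : v ∉ R) (hw : w ∉ R)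
    (huΔ : insert u R ∈ Δ) (hvΔ : insert v R ∈ Δ) (hwΔ : insert w R ∈ Δ) (hR : R ∈ Δ) : False := by
  have hnem := hne
  obtain ⟨r₀, hr₀⟩ := hne
  have hur : u ≠ r₀ := fun h => hu (h ▸ hr₀)
  have hvr : v ≠ r₀ := fun h => hv (h ▸ hr₀)
  have hwr : w ≠ r₀ := fun h => hw (h ▸ hr₀)
  let s : (R → ℝ) → ℝ := fun y => ∑ r ∈ R.attach.erase ⟨r₀, hr₀⟩, y r
  let f₀ : (R → ℝ) → Fin N → ℝ := fun y a =>
    if a = r₀ then 1 - s y - |y ⟨r₀, hr₀⟩| else if h : a ∈ R then y ⟨a, h⟩ else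
      if a = u then max (y ⟨r₀, hr₀⟩) 0 else if a = v then max (-y ⟨r₀, hr₀⟩) 0 else 0
  have hs : Continuous s := continuous_finsetSum _ fun r _ => continuous_apply r
  have hf₀ : Continuous f₀ := by
    refine continuous_pi fun a => ?_
    simp only [f₀]
    split_ifs <;> fun_prop
  let V : Set (R → ℝ) := {y | (∀ r, r ≠ ⟨r₀, hr₀⟩ → 0 < y r) ∧ s y + |y ⟨r₀, hr₀⟩| < 1}
  have hV : IsOpen V := by
    have : V = (⋂ r, ⋂ (_ : r ≠ ⟨r₀, hr₀⟩), {y | 0 < y r}) ∩ {y | s y + |y ⟨r₀, hr₀⟩| < 1} := by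
      ext; simp [V]
    rw [this]
    refine IsOpen.inter ?_ (isOpen_lt (hs.add (continuous_apply _).abs) continuous_const)
    exact isOpen_iInter_of_finite fun r => isOpen_iInter_of_finite fun _ =>
      isOpen_lt continuous_const (continuous_apply r)
  have hsum : ∀ y, ∑ a, f₀ y a = 1 := by
    intro y
    rw [← Finset.sum_add_sum_compl R]
    have h1 : ∑ a ∈ R, f₀ y a = 1 - |y ⟨r₀, hr₀⟩| := by
      rw [← Finset.sum_attach, ← Finset.add_sum_erase _ _ (mem_attach R ⟨r₀, hr₀⟩)]
      have : ∑ r ∈ R.attach.erase ⟨r₀, hr₀⟩, f₀ y r = s y := by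
        refine Finset.sum_congr rfl fun r hr => ?_
        have : r.1 ≠ r₀ := fun h => Finset.ne_of_mem_erase hr (Subtype.ext h)
        simp [f₀, this]
      rw [this]
      simp only [f₀, if_true]
      ring
    have h2 : ∑ a ∈ Rᶜ, f₀ y a = ∑ a ∈ {u, v}, f₀ y a := by
      symm
      refine Finset.sum_subset ?_ fun a ha hb => ?_
      · intro a ha
        rcases Finset.mem_insert.mp ha with rfl | h
        · simpa using hu
        · rw [Finset.mem_singleton.mp h]; simpa using hv
      · simp only [Finset.mem_insert, Finset.mem_singleton, not_or] at hb
        have h3 : a ∉ R := by simpa using ha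
        have h4 : a ≠ r₀ := fun h => h3 (h ▸ hr₀)
        simp [f₀, h3, h4, hb.1, hb.2]
    rw [h1, h2, Finset.sum_pair huv]
    simp only [f₀, hur, hvr, hu, hv, huv.symm, if_true, if_false, dite_false]
    rcases le_total 0 (y ⟨r₀, hr₀⟩) with h | h
    · rw [abs_of_nonneg h, max_eq_left h, max_eq_right (by linarith)]; ring
    · rw [abs_of_nonpos h, max_eq_right h, max_eq_left (by linarith)]; ring
  have hmem : ∀ y ∈ V, f₀ y ∈ realize Δ := by
    intro y hy
    have hnn : ∀ a, 0 ≤ f₀ y a := by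
      intro a
      simp only [f₀]
      split_ifs with h1 h2
      · linarith [hy.2]
      · exact (hy.1 ⟨a, h2⟩ fun h => h1 (congrArg Subtype.val h)).le
      · exact le_max_right _ _
      · exact le_max_right _ _
      · exact le_rfl
    rcases le_total 0 (y ⟨r₀, hr₀⟩) with h | h
    · refine ⟨insert u R, huΔ, hnn, fun a ha => ?_, hsum y⟩
      by_contra hcon
      simp only [Finset.mem_insert, not_or] at hcon
      have : a ≠ r₀ := fun h => hcon.2 (h ▸ hr₀)
      simp [f₀, hcon, this, h] at ha
    · refine ⟨insert v R, hvΔ, hnn, fun a ha => ?_, hsum y⟩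
      by_contra hcon
      simp only [Finset.mem_insert, not_or] at hcon
      have : a ≠ r₀ := fun h => hcon.2 (h ▸ hr₀)
      simp [f₀, hcon, this, h] at ha
  have hβ := barycenter_mem_realize hnem hR
  classical
  let f : (R → ℝ) → realize Δ := fun y =>
    if h : f₀ y ∈ realize Δ then ⟨f₀ y, h⟩ else ⟨barycenter R, hβ⟩
  have hfV : ∀ y ∈ V, (f y).1 = f₀ y := fun y hy => by simp [f, hmem y hy]
  have hfc : ContinuousOn f V :=
    Topology.IsInducing.subtypeVal.continuousOn_iff.mpr (hf₀.continuousOn.congr hfV)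
  have hfi : Set.InjOn f V := by
    intro y hy z hz hyz
    have h0 : f₀ y = f₀ z := by rw [← hfV y hy, ← hfV z hz, hyz]
    ext r
    by_cases hr : r = ⟨r₀, hr₀⟩
    · have h1 := congrFun h0 u
      have h2 := congrFun h0 v
      simp only [f₀, hur, hvr, hu, hv, huv.symm, if_true, if_false, dite_false] at h1 h2
      rw [hr, ← max_zero_sub_eq_self (y ⟨r₀, hr₀⟩), ← max_zero_sub_eq_self (z ⟨r₀, hr₀⟩), h1, h2]
    · have h1 := congrFun h0 r
      have : r.1 ≠ r₀ := fun h => hr (Subtype.ext h)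
      simpa [f₀, this] using h1
  have hopen := ChartedSpace.isOpen_image_of_le_finrank (E := EuclideanSpace ℝ (Fin n))
    (by simp [hcard]) hV hfc hfi
  have hRpos : 0 < #R := card_pos.mpr hnem
  have hc0 : (0 : ℝ) < (#R : ℝ)⁻¹ := by positivity
  let y₀ : R → ℝ := fun r => if r = ⟨r₀, hr₀⟩ then 0 else (#R : ℝ)⁻¹
  have hs0 : 1 - s y₀ = (#R : ℝ)⁻¹ := by
    have : s y₀ = ∑ r ∈ R.attach.erase ⟨r₀, hr₀⟩, (#R : ℝ)⁻¹ :=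
      Finset.sum_congr rfl fun r hr => by simp [y₀, Finset.ne_of_mem_erase hr]
    rw [this, Finset.sum_const, Finset.card_erase_of_mem (mem_attach _ _), Finset.card_attach,
      nsmul_eq_mul, Nat.cast_sub hRpos]
    field_simp
    push_cast; ring
  have hy₀ : y₀ ∈ V := by
    refine ⟨fun r hr => by simp [y₀, hr, hc0], ?_⟩
    have : y₀ ⟨r₀, hr₀⟩ = 0 := by simp [y₀]
    rw [this, abs_zero]; linarith
  have hfy₀ : f y₀ = ⟨barycenter R, hβ⟩ := by
    refine Subtype.ext ((hfV y₀ hy₀).trans ?_)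
    ext a
    have h0 : y₀ ⟨r₀, hr₀⟩ = 0 := by simp [y₀]
    simp only [f₀, barycenter, h0, hs0]
    by_cases h1 : a = r₀
    · simp [h1, hr₀]
    · by_cases h2 : a ∈ R <;> simp [h1, h2, y₀]
  have hnhds := hopen.mem_nhds ⟨y₀, hy₀, hfy₀⟩
  rw [nhds_subtype_eq_comap, Filter.mem_comap] at hnhds
  obtain ⟨O, hO, hOV⟩ := hnhds
  let γ : ℝ → Fin N → ℝ := fun ε => barycenter R + ε • (Pi.single w 1 - Pi.single r₀ 1)
  have hγ : Continuous γ := by fun_prop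
  have hγ0 : γ 0 = barycenter R := by simp [γ]
  have hev := hγ.continuousAt.eventually (hγ0 ▸ hO : ∀ᶠ x in nhds (γ 0), x ∈ O)
  have hev' : ∀ᶠ ε in nhdsWithin (0 : ℝ) (Set.Ioi 0), 0 < ε ∧ ε < (#R : ℝ)⁻¹ ∧ γ ε ∈ O := by
    filter_upwards [self_mem_nhdsWithin, nhdsWithin_le_nhds (gt_mem_nhds hc0),
      nhdsWithin_le_nhds hev] with ε a b c using ⟨a, b, c⟩
  obtain ⟨ε, hε, hε', hεO⟩ := hev'.exists
  have hγw : γ ε w = ε := by simp [γ, barycenter, hw, hwr]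
  have hγK : γ ε ∈ realize Δ := by
    refine ⟨insert w R, hwΔ, fun a => ?_, fun a ha => ?_, ?_⟩
    · by_cases h1 : a = r₀
      · subst h1; simp [γ, barycenter, hr₀, hwr.symm, hε'.le]
      · by_cases h2 : a = w
        · rw [h2, hγw]; exact hε.le
        · have := barycenter_nonneg R a
          simpa [γ, h1, h2] using this
    · by_contra hcon
      simp only [Finset.mem_insert, not_or] at hcon
      have : a ≠ r₀ := fun h => hcon.2 (h ▸ hr₀)
      simp [γ, barycenter, hcon.1, hcon.2, this] at ha
    · simp [γ, Finset.sum_add_distrib, sum_barycenter hnem, ← Finset.mul_sum]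
  obtain ⟨y, hy, hyγ⟩ := hOV (show (⟨γ ε, hγK⟩ : realize Δ) ∈ _ from hεO)
  have h1 : f₀ y w = ε := by rw [← hfV y hy, hyγ]; exact hγw
  simp [f₀, hwr, hw, huw.symm, hvw.symm] at h1
  exact hε.ne h1

theorem two_points_mem_realize_of_sphere
    (φ : realize Δ ≃ₜ Metric.sphere (0 : EuclideanSpace ℝ (Fin (n + 1))) 1) :
    ∃ x ∈ realize Δ, ∃ y ∈ realize Δ, x ≠ y := by
  let e : EuclideanSpace ℝ (Fin (n + 1)) := EuclideanSpace.single 0 1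
  have he : e ∈ Metric.sphere (0 : EuclideanSpace ℝ (Fin (n + 1))) 1 := by simp [e]
  have he' : -e ∈ Metric.sphere (0 : EuclideanSpace ℝ (Fin (n + 1))) 1 := by simp [e]
  refine ⟨_, (φ.symm ⟨e, he⟩).2, _, (φ.symm ⟨-e, he'⟩).2, fun h => ?_⟩
  have h1 := congrArg Subtype.val (φ.symm.injective (Subtype.ext h))
  have h2 := congrArg (fun z : EuclideanSpace ℝ (Fin (n + 1)) => z 0) h1
  simp [e] at h2
  linarith

theorem eq_or_eq_of_sphere_one {x y z : Metric.sphere (0 : EuclideanSpace ℝ (Fin 1)) 1} :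
    x = y ∨ x = z ∨ y = z := by
  have key : ∀ x : Metric.sphere (0 : EuclideanSpace ℝ (Fin 1)) 1, x.1 0 = 1 ∨ x.1 0 = -1 := by
    intro x
    have := x.2
    rw [mem_sphere_zero_iff_norm, EuclideanSpace.norm_eq, Real.sqrt_eq_one] at this
    simpa using this
  have ext' : ∀ x y : Metric.sphere (0 : EuclideanSpace ℝ (Fin 1)) 1, x.1 0 = y.1 0 → x = y := by
    intro x y h
    ext i
    rw [Subsingleton.elim i 0, h]
  rcases key x with hx | hx <;> rcases key y with hy | hy <;> rcases key z with hz | hz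
  all_goals
    first
      | exact Or.inl (ext' _ _ (hx.trans hy.symm))
      | exact Or.inr (Or.inl (ext' _ _ (hx.trans hz.symm)))
      | exact Or.inr (Or.inr (ext' _ _ (hy.trans hz.symm)))

theorem single_mem_realize {a : Fin N} (ha : {a} ∈ Δ) :
    (Pi.single a 1 : Fin N → ℝ) ∈ realize Δ := by
  refine ⟨{a}, ha, fun v => ?_, fun v hv => ?_, by simp⟩
  · by_cases h : v = a
    · subst h; simp
    · simp [h]
  · by_contra h
    simp [Finset.mem_singleton.not.mp h] at hv

/-- A triangulated sphere is a pseudomanifold without boundary. -/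
theorem card_insert_mem_of_sphere (hdown : ∀ F ∈ Δ, ∀ G ⊆ F, G ∈ Δ)
    (φ : realize Δ ≃ₜ Metric.sphere (0 : EuclideanSpace ℝ (Fin (n + 1))) 1)
    {R : Finset (Fin N)} (hR : R ∈ Δ) (hcard : #R ≤ n) :
    2 ≤ #{v | v ∉ R ∧ insert v R ∈ Δ} ∧ (#R = n → #{v | v ∉ R ∧ insert v R ∈ Δ} = 2) := by
  have : Fact (Module.finrank ℝ (EuclideanSpace ℝ (Fin (n + 1))) = n + 1) := ⟨by simp⟩
  let _ : ChartedSpace (EuclideanSpace ℝ (Fin n)) (realize Δ) :=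
    φ.pullbackChartedSpace (EuclideanSpace ℝ (Fin n))
  have h2 : 2 ≤ #{v | v ∉ R ∧ insert v R ∈ Δ} := by
    obtain ⟨u, v, huv, hu, hv, huΔ, hvΔ⟩ :
        ∃ u v, u ≠ v ∧ u ∉ R ∧ v ∉ R ∧ insert u R ∈ Δ ∧ insert v R ∈ Δ := by
      rcases R.eq_empty_or_nonempty with rfl | hne
      · obtain ⟨x, hx, y, hy, hxy⟩ := two_points_mem_realize_of_sphere φ
        by_contra! hcon
        have hsupp : ∀ z ∈ realize Δ, ∀ a, z a ≠ 0 → {a} ∈ Δ := fun z hz a ha => by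
          simpa using insert_mem_of_mem_realize hdown hz (R := ∅) (by simp) ha
        have hval : ∀ a, {a} ∈ Δ → ∀ z ∈ realize Δ, z = Pi.single a 1 := by
          intro a ha z hz
          have h0 : ∀ b, b ≠ a → z b = 0 := by
            intro b hb
            by_contra h
            exact hcon b a hb (by simp) (by simp) (by simpa using hsupp z hz b h) (by simpa using ha)
          have h1 : z a = 1 := by
            obtain ⟨-, -, -, -, h⟩ := hz
            rwa [Finset.sum_eq_single_of_mem a (mem_univ a) fun b _ hb => h0 b hb] at h
          ext b
          by_cases hb : b = a
          · subst hb; simp [h1]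
          · simp [hb, h0 b hb]
        obtain ⟨a, ha⟩ : ∃ a, x a ≠ 0 := Function.ne_iff.mp fun h => by
          obtain ⟨-, -, -, -, h1⟩ := hx
          simp [h] at h1
        have ha' := hsupp x hx a ha
        exact hxy ((hval a ha' x hx).trans (hval a ha' y hy).symm)
      · exact exists_ne_insert_mem_of_chartedSpace hdown hR hne hcard
    have : {u, v} ⊆ univ.filter fun v => v ∉ R ∧ insert v R ∈ Δ := by
      intro a ha
      rcases Finset.mem_insert.mp ha with rfl | h
      · simp [hu, huΔ]
      · rw [Finset.mem_singleton.mp h]; simp [hv, hvΔ]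
    rw [← Finset.card_pair huv]
    exact Finset.card_le_card this
  refine ⟨h2, fun hn => le_antisymm (not_lt.mp fun h3 => ?_) h2⟩
  obtain ⟨u, v, w, hu, hv, hw, huv, huw, hvw⟩ := Finset.two_lt_card_iff.mp h3
  simp only [Finset.mem_filter, mem_univ, true_and] at hu hv hw
  rcases R.eq_empty_or_nonempty with rfl | hne
  · obtain rfl : n = 0 := by simpa using hn.symm
    simp only [Finset.notMem_empty, not_false_eq_true, true_and, insert_empty_eq] at hu hv hw
    have hcol : ∀ {a b : Fin N} (ha : {a} ∈ Δ) (hb : {b} ∈ Δ), a ≠ b →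
        φ ⟨_, single_mem_realize ha⟩ ≠ φ ⟨_, single_mem_realize hb⟩ := by
      intro a b ha hb hab h
      have := congrFun (congrArg Subtype.val (φ.injective h)) a
      simp [hab] at this
    rcases eq_or_eq_of_sphere_one (x := φ ⟨_, single_mem_realize hu⟩)
      (y := φ ⟨_, single_mem_realize hv⟩) (z := φ ⟨_, single_mem_realize hw⟩) with h | h | h
    · exact hcol hu hv huv h
    · exact hcol hu hw huw h
    · exact hcol hv hw hvw h
  · exact not_three_insert_mem_of_chartedSpace hne hn huv huw hvw hu.1 hv.1 hw.1 hu.2 hv.2 hw.2 hR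

end Realization

section FlagPseudomanifold

variable {V : Type*} (G : SimpleGraph V) [DecidableRel G.Adj]

/-- The common neighbours in `W` of the vertices in `K`. -/
def commonNeighborsIn (W K : Finset V) : Finset V := W.filter fun v => ∀ k ∈ K, G.Adj v k

/-- The neighbours of `v` in `W`. -/
def neighborsIn (W : Finset V) (v : V) : Finset V := W.filter fun w => G.Adj v w

variable {G} in
theorem commonNeighborsIn_empty {W : Finset V} : commonNeighborsIn G W ∅ = W := by
  simp [commonNeighborsIn]

variable {G} in
theorem mem_neighborsIn {W : Finset V} {v w : V} : w ∈ neighborsIn G W v ↔ w ∈ W ∧ G.Adj v w := by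
  simp [neighborsIn]

variable [DecidableEq V]

/-- The cliques of `G` with all vertices in `W`. -/
def cliquesIn (W : Finset V) : Finset (Finset V) :=
  W.powerset.filter fun K => ∀ a ∈ K, ∀ b ∈ K, a ≠ b → G.Adj a b

/-- The vertices of `W` which are different from `v` and not adjacent to it. -/
def nonneighborsIn (W : Finset V) (v : V) : Finset V := W.filter fun w => w ≠ v ∧ ¬G.Adj v w

/-- The number of cliques of size `k` in `W`. -/
def cliqueCount (W : Finset V) (k : ℕ) : ℕ := #{K ∈ cliquesIn G W | #K = k}

/-- The `h`-polynomial of the clique complex of `G` on `W`. -/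
noncomputable def cliqueHPoly (d : ℕ) (W : Finset V) : ℤ[X] :=
  ∑ K ∈ cliquesIn G W, X ^ #K * (1 - X) ^ (d - #K)

/-- The clique complex of `G` on `W` is a `(d-1)`-dimensional pseudomanifold without boundary. -/
structure IsFlagPseudomanifold (d : ℕ) (W : Finset V) : Prop where
  card_le : ∀ K ∈ cliquesIn G W, #K ≤ d
  two_le : ∀ K ∈ cliquesIn G W, #K < d → 2 ≤ #(commonNeighborsIn G W K)
  eq_two : ∀ K ∈ cliquesIn G W, #K + 1 = d → #(commonNeighborsIn G W K) = 2

variable {G} {W : Finset V} {d : ℕ} {v w : V}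

theorem mem_cliquesIn {K : Finset V} :
    K ∈ cliquesIn G W ↔ K ⊆ W ∧ ∀ a ∈ K, ∀ b ∈ K, a ≠ b → G.Adj a b := by
  simp [cliquesIn]

theorem mem_nonneighborsIn : w ∈ nonneighborsIn G W v ↔ w ∈ W ∧ w ≠ v ∧ ¬G.Adj v w := by
  simp [nonneighborsIn]

theorem empty_mem_cliquesIn : ∅ ∈ cliquesIn G W := by simp [mem_cliquesIn]

theorem singleton_mem_cliquesIn (hv : v ∈ W) : {v} ∈ cliquesIn G W := by
  simp [mem_cliquesIn, hv]

theorem insert_mem_cliquesIn (hv : v ∈ W) {K : Finset V}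
    (hK : K ∈ cliquesIn G (neighborsIn G W v)) :
    insert v K ∈ cliquesIn G W := by
  rw [mem_cliquesIn] at *
  have hadj : ∀ a ∈ K, G.Adj v a := fun a ha => (mem_neighborsIn.mp (hK.1 ha)).2
  refine ⟨insert_subset hv fun a ha => (mem_neighborsIn.mp (hK.1 ha)).1, ?_⟩
  intro a ha b hb hab
  rcases mem_insert.mp ha with rfl | ha' <;> rcases mem_insert.mp hb with rfl | hb'
  · exact absurd rfl hab
  · exact hadj b hb'
  · exact (hadj a ha').symm
  · exact hK.2 a ha' b hb' hab

theorem notMem_of_mem_cliquesIn_neighborsIn {K : Finset V}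
    (hK : K ∈ cliquesIn G (neighborsIn G W v)) : v ∉ K := fun h =>
  G.irrefl (mem_neighborsIn.mp ((mem_cliquesIn.mp hK).1 h)).2

theorem commonNeighborsIn_neighborsIn (K : Finset V) :
    commonNeighborsIn G (neighborsIn G W v) K = commonNeighborsIn G W (insert v K) := by
  ext w
  simp only [commonNeighborsIn, neighborsIn, mem_filter, mem_insert, forall_eq_or_imp, and_assoc,
    G.adj_comm v w]

theorem card_eq_neighborsIn_add_nonneighborsIn (hv : v ∈ W) :
    #W = 1 + #(neighborsIn G W v) + #(nonneighborsIn G W v) := by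
  have h1 : W = insert v (neighborsIn G W v ∪ nonneighborsIn G W v) := by
    ext w
    simp only [mem_insert, mem_union, mem_neighborsIn, mem_nonneighborsIn]
    constructor
    · intro hw
      by_cases h : w = v <;> by_cases h' : G.Adj v w <;> simp [*]
    · rintro (rfl | h | h)
      exacts [hv, h.1, h.1]
  have h2 : v ∉ neighborsIn G W v ∪ nonneighborsIn G W v := by
    simp [mem_neighborsIn, mem_nonneighborsIn]
  have h3 : Disjoint (neighborsIn G W v) (nonneighborsIn G W v) := by
    rw [Finset.disjoint_left]
    intro a ha hb
    exact (mem_nonneighborsIn.mp hb).2.2 (mem_neighborsIn.mp ha).2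
  conv_lhs => rw [h1]
  rw [card_insert_of_notMem h2, card_union_of_disjoint h3]
  ring

namespace IsFlagPseudomanifold

theorem neighborsIn (h : IsFlagPseudomanifold G (d + 1) W) (hv : v ∈ W) :
    IsFlagPseudomanifold G d (neighborsIn G W v) := by
  have key : ∀ K ∈ cliquesIn G (_root_.neighborsIn G W v), #(insert v K) = #K + 1 := fun K hK =>
    card_insert_of_notMem (notMem_of_mem_cliquesIn_neighborsIn hK)
  refine ⟨fun K hK => ?_, fun K hK hd => ?_, fun K hK hd => ?_⟩
  · have := h.card_le _ (insert_mem_cliquesIn hv hK)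
    rw [key K hK] at this
    omega
  · rw [commonNeighborsIn_neighborsIn]
    exact h.two_le _ (insert_mem_cliquesIn hv hK) (by rw [key K hK]; omega)
  · rw [commonNeighborsIn_neighborsIn]
    exact h.eq_two _ (insert_mem_cliquesIn hv hK) (by rw [key K hK]; omega)

theorem eq_empty (h : IsFlagPseudomanifold G 0 W) : W = ∅ := by
  by_contra hne
  obtain ⟨v, hv⟩ := nonempty_iff_ne_empty.mpr hne
  simpa using h.card_le _ (singleton_mem_cliquesIn hv)

theorem pos_of_mem (h : IsFlagPseudomanifold G d W) (hv : v ∈ W) : 0 < d := by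
  have := h.card_le _ (singleton_mem_cliquesIn hv)
  rwa [card_singleton] at this

theorem two_le_card (h : IsFlagPseudomanifold G (d + 1) W) : 2 ≤ #W := by
  simpa [commonNeighborsIn_empty] using h.two_le ∅ empty_mem_cliquesIn (by simp)

theorem card_eq_two (h : IsFlagPseudomanifold G 1 W) : #W = 2 := by
  simpa [commonNeighborsIn_empty] using h.eq_two ∅ empty_mem_cliquesIn (by simp)

theorem nonempty (h : IsFlagPseudomanifold G (d + 1) W) : W.Nonempty :=
  card_pos.mp (by have := h.two_le_card; omega)

theorem nonneighborsIn_nonempty (h : IsFlagPseudomanifold G d W) (hv : v ∈ W) :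
    (nonneighborsIn G W v).Nonempty := by
  induction d generalizing W v with
  | zero => simp [h.eq_empty] at hv
  | succ d ih =>
    obtain ⟨u, hu, huv⟩ := exists_mem_ne h.two_le_card v
    by_cases hd : d = 0
    · subst hd
      refine ⟨u, mem_nonneighborsIn.mpr ⟨hu, huv, fun hadj => ?_⟩⟩
      have := h.card_le _ (insert_mem_cliquesIn hv
        (singleton_mem_cliquesIn (mem_neighborsIn.mpr ⟨hu, hadj⟩)))
      rw [card_pair huv.symm] at this
      omega
    · obtain ⟨d, rfl⟩ := Nat.exists_eq_succ_of_ne_zero hd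
      obtain ⟨u, hu⟩ := (h.neighborsIn hv).nonempty
      rw [mem_neighborsIn] at hu
      obtain ⟨w, hw⟩ := ih (h.neighborsIn hu.1) (mem_neighborsIn.mpr ⟨hv, hu.2.symm⟩)
      rw [mem_nonneighborsIn, mem_neighborsIn] at hw
      exact ⟨w, mem_nonneighborsIn.mpr ⟨hw.1.1, hw.2⟩⟩

theorem two_mul_le_card (h : IsFlagPseudomanifold G d W) : 2 * d ≤ #W := by
  induction d generalizing W with
  | zero => simp
  | succ d ih =>
    obtain ⟨v, hv⟩ := h.nonempty
    have h1 := ih (h.neighborsIn hv)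
    have h2 := card_pos.mpr (h.nonneighborsIn_nonempty hv)
    have h3 := card_eq_neighborsIn_add_nonneighborsIn (G := G) hv
    omega

theorem card_nonneighborsIn_le (h : IsFlagPseudomanifold G (d + 1) W) (hv : v ∈ W) :
    #(nonneighborsIn G W v) + 2 * d + 1 ≤ #W := by
  have h1 := (h.neighborsIn hv).two_mul_le_card
  have h3 := card_eq_neighborsIn_add_nonneighborsIn (G := G) hv
  omega

theorem card_nonneighborsIn_eq_one (h : IsFlagPseudomanifold G d W) (hW : #W = 2 * d)
    (hv : v ∈ W) : #(nonneighborsIn G W v) = 1 := by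
  have h2 := card_pos.mpr (h.nonneighborsIn_nonempty hv)
  obtain ⟨d, rfl⟩ := Nat.exists_eq_succ_of_ne_zero (h.pos_of_mem hv).ne'
  have h3 := h.card_nonneighborsIn_le hv
  omega

theorem nonneighborsIn_eq_singleton (h : IsFlagPseudomanifold G d W) (hv : v ∈ W)
    (hvw : nonneighborsIn G W v = {w}) : nonneighborsIn G W w = {v} := by
  obtain ⟨d, rfl⟩ := Nat.exists_eq_succ_of_ne_zero (h.pos_of_mem hv).ne'
  have hw := mem_nonneighborsIn.mp (hvw.symm ▸ mem_singleton_self w)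
  refine eq_singleton_iff_unique_mem.mpr ⟨mem_nonneighborsIn.mpr
    ⟨hv, hw.2.1.symm, fun h => hw.2.2 h.symm⟩, fun x hx => ?_⟩
  rw [mem_nonneighborsIn] at hx
  by_contra hxv
  have hvx : G.Adj v x := by
    by_contra hna
    have : x ∈ nonneighborsIn G W v := mem_nonneighborsIn.mpr ⟨hx.1, hxv, hna⟩
    rw [hvw, mem_singleton] at this
    exact hx.2.1 this
  obtain ⟨y, hy⟩ := (h.neighborsIn hx.1).nonneighborsIn_nonempty
    (mem_neighborsIn.mpr ⟨hv, hvx.symm⟩)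
  rw [mem_nonneighborsIn, mem_neighborsIn] at hy
  have : y ∈ nonneighborsIn G W v := mem_nonneighborsIn.mpr ⟨hy.1.1, hy.2⟩
  rw [hvw, mem_singleton] at this
  subst this
  exact hx.2.2 hy.1.2.symm

end IsFlagPseudomanifold

theorem sum_cliquesIn_eq {A : Type*} [AddCommMonoid A] (φ : ℕ → A) (hv : v ∈ W) :
    ∑ K ∈ cliquesIn G W, φ #K =
      ∑ K ∈ cliquesIn G (W.erase v), φ #K + ∑ K ∈ cliquesIn G (neighborsIn G W v), φ (#K + 1) := by
  rw [← sum_filter_not_add_sum_filter _ (fun K => v ∈ K)]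
  congr 1
  · refine sum_congr ?_ fun _ _ => rfl
    ext K
    simp only [mem_filter, mem_cliquesIn, subset_erase]
    tauto
  · symm
    refine sum_bij (fun K _ => insert v K) (fun K hK => ?_) (fun K hK K' hK' hKK => ?_)
      (fun K hK => ?_) fun K hK => ?_
    · exact mem_filter.mpr ⟨insert_mem_cliquesIn hv hK, mem_insert_self _ _⟩
    · rw [← erase_insert (notMem_of_mem_cliquesIn_neighborsIn hK), hKK,
        erase_insert (notMem_of_mem_cliquesIn_neighborsIn hK')]
    · obtain ⟨hK, hvK⟩ := mem_filter.mp hK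
      rw [mem_cliquesIn] at hK
      refine ⟨K.erase v, mem_cliquesIn.mpr ⟨fun a ha => ?_, fun a ha b hb => ?_⟩,
        insert_erase hvK⟩
      · obtain ⟨hav, ha⟩ := mem_erase.mp ha
        exact mem_neighborsIn.mpr ⟨hK.1 ha, hK.2 v hvK a ha hav.symm⟩
      · exact hK.2 a (mem_of_mem_erase ha) b (mem_of_mem_erase hb)
    · rw [card_insert_of_notMem (notMem_of_mem_cliquesIn_neighborsIn hK)]

theorem card_filter_mem_cliquesIn (hv : v ∈ W) (k : ℕ) :
    #{K ∈ cliquesIn G W | #K = k + 1 ∧ v ∈ K} = cliqueCount G (neighborsIn G W v) k := by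
  symm
  refine card_bij (fun K _ => insert v K) (fun K hK => ?_) (fun K hK K' hK' hKK => ?_)
    (fun K hK => ?_)
  · rw [mem_filter] at hK ⊢
    exact ⟨insert_mem_cliquesIn hv hK.1, by
      rw [card_insert_of_notMem (notMem_of_mem_cliquesIn_neighborsIn hK.1), hK.2],
      mem_insert_self _ _⟩
  · rw [← erase_insert (notMem_of_mem_cliquesIn_neighborsIn (mem_filter.mp hK).1), hKK,
      erase_insert (notMem_of_mem_cliquesIn_neighborsIn (mem_filter.mp hK').1)]
  · obtain ⟨hK, hc, hvK⟩ := mem_filter.mp hK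
    rw [mem_cliquesIn] at hK
    refine ⟨K.erase v, mem_filter.mpr ⟨mem_cliquesIn.mpr ⟨fun a ha => ?_, fun a ha b hb => ?_⟩, ?_⟩,
      insert_erase hvK⟩
    · obtain ⟨hav, ha⟩ := mem_erase.mp ha
      exact mem_neighborsIn.mpr ⟨hK.1 ha, hK.2 v hvK a ha hav.symm⟩
    · exact hK.2 a (mem_of_mem_erase ha) b (mem_of_mem_erase hb)
    · rw [card_erase_of_mem hvK, hc, Nat.add_sub_cancel]

theorem sum_cliqueCount_neighborsIn (W : Finset V) (k : ℕ) :
    ∑ v ∈ W, cliqueCount G (neighborsIn G W v) k = (k + 1) * cliqueCount G W (k + 1) := by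
  have h1 : ∀ v ∈ W, cliqueCount G (neighborsIn G W v) k =
      #(bipartiteAbove (fun (v : V) K => v ∈ K) {K ∈ cliquesIn G W | #K = k + 1} v) := by
    intro v hv
    rw [← card_filter_mem_cliquesIn hv, bipartiteAbove, filter_filter]
  rw [sum_congr rfl h1, sum_card_bipartiteAbove_eq_sum_card_bipartiteBelow]
  have h2 : ∀ K ∈ {K ∈ cliquesIn G W | #K = k + 1},
      #(bipartiteBelow (fun (v : V) K => v ∈ K) W K) = k + 1 := by
    intro K hK
    rw [mem_filter, mem_cliquesIn] at hK
    rw [← hK.2, bipartiteBelow, filter_mem_eq_inter, inter_eq_right.mpr hK.1.1]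
  rw [sum_congr rfl h2, sum_const, smul_eq_mul, mul_comm, cliqueCount]

theorem cliqueCount_zero : cliqueCount G W 0 = 1 := by
  rw [cliqueCount, card_eq_one]
  refine ⟨∅, eq_singleton_iff_unique_mem.mpr ⟨?_, fun K hK => ?_⟩⟩
  · simp [empty_mem_cliquesIn]
  · simpa using (mem_filter.mp hK).2

theorem cliqueCount_one : cliqueCount G W 1 = #W := by
  have := sum_cliqueCount_neighborsIn (G := G) W 0
  simpa [cliqueCount_zero] using this.symm

theorem IsFlagPseudomanifold.mul_cliqueCount (h : IsFlagPseudomanifold G (d + 1) W) :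
    (d + 1) * cliqueCount G W (d + 1) = 2 * cliqueCount G W d := by
  induction d generalizing W with
  | zero => simp [cliqueCount_zero, cliqueCount_one, h.card_eq_two]
  | succ d ih =>
    have h1 := sum_cliqueCount_neighborsIn (G := G) W (d + 1)
    have h2 := sum_cliqueCount_neighborsIn (G := G) W d
    have h3 : (d + 1) * ∑ v ∈ W, cliqueCount G (_root_.neighborsIn G W v) (d + 1) =
        2 * ∑ v ∈ W, cliqueCount G (_root_.neighborsIn G W v) d := by
      rw [mul_sum, mul_sum]
      exact sum_congr rfl fun v hv => ih (h.neighborsIn hv)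
    rw [h1, h2] at h3
    refine Nat.eq_of_mul_eq_mul_left (Nat.succ_pos d) ?_
    rw [Nat.succ_eq_add_one, h3]
    ring

theorem IsFlagPseudomanifold.cliqueHPoly_eq (h : IsFlagPseudomanifold G d W) :
    cliqueHPoly G d W =
      ∑ k ∈ range (d + 1), (cliqueCount G W k : ℤ[X]) * (X ^ k * (1 - X) ^ (d - k)) := by
  rw [cliqueHPoly, ← sum_fiberwise_of_maps_to (t := range (d + 1)) (g := card) fun K hK => by
    have := h.card_le K hK
    simp; omega]
  refine sum_congr rfl fun k _ => ?_
  rw [sum_congr rfl fun K hK => by rw [(mem_filter.mp hK).2], sum_const, nsmul_eq_mul, cliqueCount]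

theorem card_nonneighborsIn_eq_add (hvw : w ∈ neighborsIn G W v) :
    #(nonneighborsIn G W w) = #(nonneighborsIn G (neighborsIn G W v) w) +
      #{y ∈ nonneighborsIn G W v | ¬G.Adj w y} := by
  rw [← card_union_of_disjoint]
  · congr 1
    have hvw' := mem_neighborsIn.mp hvw
    ext y
    simp only [mem_union, mem_filter, mem_nonneighborsIn, mem_neighborsIn]
    constructor
    · rintro ⟨hy, hyw, hna⟩
      by_cases hvy : G.Adj v y
      · exact Or.inl ⟨⟨hy, hvy⟩, hyw, hna⟩
      · refine Or.inr ⟨⟨hy, ?_, hvy⟩, hna⟩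
        rintro rfl
        exact hna hvw'.2.symm
    · rintro (⟨⟨hy, hvy⟩, hyw, hna⟩ | ⟨⟨hy, hyv, hvy⟩, hna⟩)
      · exact ⟨hy, hyw, hna⟩
      · refine ⟨hy, ?_, hna⟩
        rintro rfl
        exact hvy hvw'.2
  · rw [Finset.disjoint_left]
    intro y hy hy'
    exact (mem_nonneighborsIn.mp (mem_filter.mp hy').1).2.2
      (mem_neighborsIn.mp (mem_nonneighborsIn.mp hy).1).2

theorem sum_card_nonneighborsIn_add_le (hv : v ∈ W) :
    ∑ x ∈ neighborsIn G W v, #(nonneighborsIn G W x) + #(nonneighborsIn G W v) ≤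
      ∑ y ∈ nonneighborsIn G W v, #(nonneighborsIn G W y) +
        ∑ x ∈ neighborsIn G W v, #(nonneighborsIn G (neighborsIn G W v) x) := by
  rw [sum_congr rfl fun x hx => card_nonneighborsIn_eq_add hx, sum_add_distrib]
  have h1 : ∑ x ∈ neighborsIn G W v, #{y ∈ nonneighborsIn G W v | ¬G.Adj x y} =
      ∑ y ∈ nonneighborsIn G W v, #{x ∈ neighborsIn G W v | ¬G.Adj x y} :=
    sum_card_bipartiteAbove_eq_sum_card_bipartiteBelow fun x y => ¬G.Adj x y
  have h2 : ∑ y ∈ nonneighborsIn G W v, #{x ∈ neighborsIn G W v | ¬G.Adj x y} +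
      #(nonneighborsIn G W v) ≤ ∑ y ∈ nonneighborsIn G W v, #(nonneighborsIn G W y) := by
    rw [card_eq_sum_ones (nonneighborsIn G W v), ← sum_add_distrib]
    refine sum_le_sum fun y hy => ?_
    rw [mem_nonneighborsIn] at hy
    have hvn : v ∉ ({x ∈ neighborsIn G W v | ¬G.Adj x y} : Finset V) := by
      simp [mem_neighborsIn]
    rw [← card_insert_of_notMem hvn]
    refine card_le_card fun x hx => ?_
    rw [mem_insert, mem_filter, mem_neighborsIn] at hx
    rw [mem_nonneighborsIn]
    rcases hx with rfl | ⟨⟨hx, hvx⟩, hna⟩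
    · exact ⟨hv, hy.2.1.symm, fun h => hy.2.2 h.symm⟩
    · refine ⟨hx, ?_, fun h => hna h.symm⟩
      rintro rfl
      exact hy.2.2 hvx
  omega

namespace IsFlagPseudomanifold

theorem two_le_card_nonneighborsIn (h : IsFlagPseudomanifold G d W)
    (hno : ∀ v ∈ W, #(nonneighborsIn G W v) ≠ 1) (hv : v ∈ W) : 2 ≤ #(nonneighborsIn G W v) := by
  have h1 := card_pos.mpr (h.nonneighborsIn_nonempty hv)
  have h2 := hno v hv
  omega

theorem eq_two_of_card_eq (h : IsFlagPseudomanifold G d W) (hW : #W = 2 * d + 1)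
    (hno : ∀ v ∈ W, #(nonneighborsIn G W v) ≠ 1) :
    d = 2 ∧ ∀ v ∈ W, #(nonneighborsIn G W v) = 2 := by
  obtain _ | d := d
  · simp [h.eq_empty] at hW
  have hall : ∀ v ∈ W, #(nonneighborsIn G W v) = 2 := fun v hv => by
    have := h.two_le_card_nonneighborsIn hno hv
    have := h.card_nonneighborsIn_le hv
    omega
  refine ⟨?_, hall⟩
  obtain ⟨v, hv⟩ := h.nonempty
  have h1 := card_eq_neighborsIn_add_nonneighborsIn (G := G) hv
  rw [hall v hv] at h1
  have h2 := sum_card_nonneighborsIn_add_le (G := G) hv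
  rw [sum_congr rfl fun x hx => hall x (mem_neighborsIn.mp hx).1,
    sum_congr rfl fun x hx => hall x (mem_nonneighborsIn.mp hx).1,
    sum_congr rfl fun x hx => (h.neighborsIn hv).card_nonneighborsIn_eq_one (by omega) hx,
    hall v hv] at h2
  simp only [sum_const, smul_eq_mul, hall v hv] at h2
  have h3 : d ≠ 0 := by
    rintro rfl
    have := h.card_eq_two
    omega
  omega

theorem exists_suspension (h : IsFlagPseudomanifold G d W) (hv : v ∈ W)
    (hone : #(nonneighborsIn G W v) = 1) :
    ∃ w ∈ W, w ≠ v ∧ nonneighborsIn G W v = {w} ∧ nonneighborsIn G W w = {v} ∧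
      _root_.neighborsIn G W w = _root_.neighborsIn G W v ∧
      (W.erase v).erase w = _root_.neighborsIn G W v := by
  obtain ⟨w, hw⟩ := card_eq_one.mp hone
  have hw' := h.nonneighborsIn_eq_singleton hv hw
  have hwm := mem_nonneighborsIn.mp (hw.symm ▸ mem_singleton_self w)
  have h1 : ∀ x ∈ W, ¬G.Adj v x → x = v ∨ x = w := fun x hx hna => by
    by_contra! hcon
    have : x ∈ nonneighborsIn G W v := mem_nonneighborsIn.mpr ⟨hx, hcon.1, hna⟩
    exact hcon.2 (by simpa [hw] using this)
  have h2 : ∀ x ∈ W, ¬G.Adj w x → x = w ∨ x = v := fun x hx hna => by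
    by_contra! hcon
    have : x ∈ nonneighborsIn G W w := mem_nonneighborsIn.mpr ⟨hx, hcon.1, hna⟩
    exact hcon.2 (by simpa [hw'] using this)
  have h3 : (W.erase v).erase w = _root_.neighborsIn G W v := by
    ext x
    rw [mem_erase, mem_erase, mem_neighborsIn]
    constructor
    · rintro ⟨hxw, hxv, hx⟩
      exact ⟨hx, by_contra fun hna => (h1 x hx hna).elim hxv hxw⟩
    · rintro ⟨hx, hvx⟩
      refine ⟨?_, hvx.ne', hx⟩
      rintro rfl
      exact hwm.2.2 hvx
  refine ⟨w, hwm.1, hwm.2.1, hw, hw', ?_, h3⟩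
  rw [← h3]
  ext x
  rw [mem_erase, mem_erase, mem_neighborsIn]
  constructor
  · rintro ⟨hx, hwx⟩
    refine ⟨hwx.ne', ?_, hx⟩
    rintro rfl
    exact hwm.2.2 hwx.symm
  · rintro ⟨hxw, hxv, hx⟩
    exact ⟨hx, by_contra fun hna => (h2 x hx hna).elim hxw hxv⟩

theorem sum_card_nonneighborsIn_eq (h : IsFlagPseudomanifold G d W) (hW : #W = 2 * d + 1) :
    ∑ v ∈ W, #(nonneighborsIn G W v) = 2 * d + 6 := by
  induction d generalizing W with
  | zero => simp [h.eq_empty] at hW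
  | succ d ih =>
    by_cases hno : ∀ v ∈ W, #(nonneighborsIn G W v) ≠ 1
    · obtain ⟨hd, hall⟩ := h.eq_two_of_card_eq hW hno
      rw [sum_congr rfl hall, sum_const, smul_eq_mul, hW]
      omega
    · push Not at hno
      obtain ⟨v, hv, hone⟩ := hno
      obtain ⟨w, hw, hwv, hnv, hnw, hnbr, herase⟩ := h.exists_suspension hv hone
      have h1 := card_eq_neighborsIn_add_nonneighborsIn (G := G) hv
      have h2 := ih (h.neighborsIn hv) (by omega)
      rw [← add_sum_erase _ _ hv, ← add_sum_erase _ _ (mem_erase.mpr ⟨hwv, hw⟩), herase, hnv, hnw,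
        card_singleton, card_singleton]
      have h3 : ∀ x ∈ _root_.neighborsIn G W v, #(nonneighborsIn G W x) =
          #(nonneighborsIn G (_root_.neighborsIn G W v) x) := by
        intro x hx
        rw [card_nonneighborsIn_eq_add hx, hnv, Nat.add_eq_left, card_eq_zero,
          filter_singleton, if_neg]
        rw [← hnbr, mem_neighborsIn] at hx
        exact not_not_intro hx.2.symm
      rw [sum_congr rfl h3, h2]
      omega

theorem cliqueHPoly_of_suspension (h : IsFlagPseudomanifold G (d + 1) W) (hv : v ∈ W)
    (hone : #(nonneighborsIn G W v) = 1) :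
    cliqueHPoly G (d + 1) W = (1 + X) * cliqueHPoly G d (_root_.neighborsIn G W v) := by
  obtain ⟨w, hw, hwv, hnv, hnw, hnbr, herase⟩ := h.exists_suspension hv hone
  have h1 : _root_.neighborsIn G (W.erase v) w = _root_.neighborsIn G W v := by
    rw [← hnbr]
    ext x
    rw [mem_neighborsIn, mem_neighborsIn, mem_erase]
    refine ⟨fun hx => ⟨hx.1.2, hx.2⟩, fun hx => ⟨⟨?_, hx.1⟩, hx.2⟩⟩
    rintro rfl
    have : w ∈ nonneighborsIn G W x := by simp [hnv]
    exact (mem_nonneighborsIn.mp this).2.2 hx.2.symm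
  let φ : ℕ → ℤ[X] := fun k => X ^ k * (1 - X) ^ (d + 1 - k)
  have h2 := sum_cliquesIn_eq (G := G) φ hv
  rw [sum_cliquesIn_eq (G := G) φ (mem_erase.mpr ⟨hwv, hw⟩), herase, h1] at h2
  simp only [φ] at h2
  rw [cliqueHPoly, h2, cliqueHPoly, mul_sum, ← sum_add_distrib, ← sum_add_distrib]
  refine sum_congr rfl fun K hK => ?_
  have hK' := (h.neighborsIn hv).card_le K hK
  rw [Nat.add_sub_add_right, Nat.succ_sub hK', pow_succ, pow_succ]
  ring

theorem sum_card_neighborsIn (W : Finset V) :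
    ∑ v ∈ W, #(_root_.neighborsIn G W v) = 2 * cliqueCount G W 2 := by
  have := sum_cliqueCount_neighborsIn (G := G) W 1
  simpa only [cliqueCount_one] using this

theorem forall_of_card_eq_three (h : IsFlagPseudomanifold G d W) (hd : 4 ≤ d)
    (hW : #W = 2 * d + 2) (hno : ∀ v ∈ W, #(nonneighborsIn G W v) ≠ 1) (hv : v ∈ W)
    (hthree : #(nonneighborsIn G W v) = 3) :
    (∀ y ∈ nonneighborsIn G W v, #(nonneighborsIn G W y) = 3) ∧
      ∀ x ∈ _root_.neighborsIn G W v, #(nonneighborsIn G W x) = 2 := by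
  obtain ⟨d, rfl⟩ := Nat.exists_eq_succ_of_ne_zero (by omega : d ≠ 0)
  have hlow : ∀ x ∈ W, 2 ≤ #(nonneighborsIn G W x) := fun x hx =>
    h.two_le_card_nonneighborsIn hno hx
  have hupp : ∀ x ∈ W, #(nonneighborsIn G W x) ≤ 3 := fun x hx => by
    have := h.card_nonneighborsIn_le hx
    omega
  have h1 := card_eq_neighborsIn_add_nonneighborsIn (G := G) hv
  have h2 := sum_card_nonneighborsIn_add_le (G := G) hv
  rw [sum_congr rfl fun x hx => (h.neighborsIn hv).card_nonneighborsIn_eq_one (by omega) hx,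
    sum_const, smul_eq_mul, mul_one] at h2
  have h3 : ∑ y ∈ nonneighborsIn G W v, #(nonneighborsIn G W y) ≤ ∑ y ∈ nonneighborsIn G W v, 3 :=
    sum_le_sum fun y hy => hupp y (mem_nonneighborsIn.mp hy).1
  have h4 : ∑ x ∈ _root_.neighborsIn G W v, 2 ≤
      ∑ x ∈ _root_.neighborsIn G W v, #(nonneighborsIn G W x) :=
    sum_le_sum fun x hx => hlow x (mem_neighborsIn.mp hx).1
  have h3' := h3
  have h4' := h4
  simp only [sum_const, smul_eq_mul] at h3' h4'
  constructor
  · refine (sum_eq_sum_iff_of_le fun y hy => hupp y (mem_nonneighborsIn.mp hy).1).mp ?_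
    rw [sum_const, smul_eq_mul]
    omega
  · intro x hx
    refine ((sum_eq_sum_iff_of_le fun y hy => hlow y (mem_neighborsIn.mp hy).1).mp ?_ x hx).symm
    rw [sum_const, smul_eq_mul]
    omega

theorem card_nonneighborsIn_eq_two (h : IsFlagPseudomanifold G d W) (hd : 4 ≤ d)
    (hW : #W = 2 * d + 2) (hno : ∀ v ∈ W, #(nonneighborsIn G W v) ≠ 1) (hv : v ∈ W) :
    #(nonneighborsIn G W v) = 2 := by
  obtain ⟨d, rfl⟩ := Nat.exists_eq_succ_of_ne_zero (by omega : d ≠ 0)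
  have h1 := h.two_le_card_nonneighborsIn hno hv
  have h2 := h.card_nonneighborsIn_le hv
  by_contra hne
  have hthree : #(nonneighborsIn G W v) = 3 := by omega
  have hcard := card_eq_neighborsIn_add_nonneighborsIn (G := G) hv
  obtain ⟨hnon, hnbr⟩ := h.forall_of_card_eq_three hd hW hno hv hthree
  obtain ⟨x, hx⟩ : (_root_.neighborsIn G W v).Nonempty := card_pos.mp (by omega)
  have h3 := hnbr x hx
  rw [card_nonneighborsIn_eq_add hx,
    (h.neighborsIn hv).card_nonneighborsIn_eq_one (by omega) hx] at h3
  obtain ⟨y, hy⟩ := card_pos.mp (show 0 < #{y ∈ nonneighborsIn G W v | ¬G.Adj x y} by omega)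
  obtain ⟨hy, hxy⟩ := mem_filter.mp hy
  obtain ⟨hnon', -⟩ :=
    h.forall_of_card_eq_three hd hW hno (mem_nonneighborsIn.mp hy).1 (hnon y hy)
  have hxv := mem_neighborsIn.mp hx
  have h4 := hnon' x (mem_nonneighborsIn.mpr ⟨hxv.1, by
    rintro rfl
    exact (mem_nonneighborsIn.mp hy).2.2 hxv.2, fun h => hxy h.symm⟩)
  have h5 := hnbr x hx
  omega

theorem cliqueHPoly_of_card_eq (h : IsFlagPseudomanifold G 2 W) (hW : #W = 5 ∨ #W = 6) :
    cliqueHPoly G 2 W = (1 + X) ^ 2 + ((#W - 4 : ℕ) : ℤ[X]) * X := by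
  have h1 : 2 * cliqueCount G W 2 = 2 * cliqueCount G W 1 := h.mul_cliqueCount
  have h2 : cliqueCount G W 2 = #W := by rw [← cliqueCount_one (G := G)]; omega
  rw [h.cliqueHPoly_eq]
  simp only [sum_range_succ, range_zero, sum_empty, cliqueCount_zero, cliqueCount_one, h2]
  rcases hW with h | h <;> rw [h] <;> norm_num <;> ring

theorem cliqueHPoly_three (h : IsFlagPseudomanifold G 3 W) (hW : #W = 8)
    (hno : ∀ v ∈ W, #(nonneighborsIn G W v) ≠ 1) :
    cliqueHPoly G 3 W = (1 + X) ^ 3 + 2 * X * (1 + X) := by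
  have h1 : 3 * cliqueCount G W 3 = 2 * cliqueCount G W 2 := h.mul_cliqueCount
  have h2 := sum_card_neighborsIn (G := G) W
  have h3 : ∑ v ∈ W, #(_root_.neighborsIn G W v) ≤ ∑ v ∈ W, 5 := sum_le_sum fun v hv => by
    have := card_eq_neighborsIn_add_nonneighborsIn (G := G) hv
    have := h.two_le_card_nonneighborsIn hno hv
    omega
  have h4 : ∑ v ∈ W, 4 ≤ ∑ v ∈ W, #(_root_.neighborsIn G W v) := sum_le_sum fun v hv => by
    have := (h.neighborsIn hv).two_mul_le_card
    omega
  rw [sum_const, smul_eq_mul, hW] at h3 h4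
  have h5 : cliqueCount G W 2 = 18 := by omega
  have h6 : cliqueCount G W 3 = 12 := by omega
  rw [h.cliqueHPoly_eq]
  simp only [sum_range_succ, range_zero, sum_empty, cliqueCount_zero, cliqueCount_one, h5, h6, hW]
  norm_num
  ring

theorem cliqueHPoly_of_four_le (h : IsFlagPseudomanifold G d W) (hd : 4 ≤ d)
    (hW : #W = 2 * d + 2) (hno : ∀ v ∈ W, #(nonneighborsIn G W v) ≠ 1) :
    d = 4 ∧ cliqueHPoly G 4 W = (1 + X) ^ 4 + 2 * X * (1 + X) ^ 2 + X ^ 2 := by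
  have hall : ∀ v ∈ W, #(nonneighborsIn G W v) = 2 := fun v hv =>
    h.card_nonneighborsIn_eq_two hd hW hno hv
  obtain ⟨d, rfl⟩ := Nat.exists_eq_succ_of_ne_zero (by omega : d ≠ 0)
  have hnb : ∀ v ∈ W, #(_root_.neighborsIn G W v) = 2 * d + 1 := fun v hv => by
    have := card_eq_neighborsIn_add_nonneighborsIn (G := G) hv
    have := hall v hv
    omega
  have hd4 : d = 3 := by
    obtain ⟨v, hv⟩ := h.nonempty
    have h2 := sum_card_nonneighborsIn_add_le (G := G) hv
    rw [sum_congr rfl fun x hx => hall x (mem_neighborsIn.mp hx).1,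
      sum_congr rfl fun x hx => hall x (mem_nonneighborsIn.mp hx).1,
      (h.neighborsIn hv).sum_card_nonneighborsIn_eq (hnb v hv)] at h2
    simp only [sum_const, smul_eq_mul, hnb v hv, hall v hv] at h2
    omega
  subst hd4
  refine ⟨rfl, ?_⟩
  have h1 : 4 * cliqueCount G W 4 = 2 * cliqueCount G W 3 := h.mul_cliqueCount
  have h2 : cliqueCount G W 2 = 35 := by
    have := sum_card_neighborsIn (G := G) W
    rw [sum_congr rfl hnb, sum_const, smul_eq_mul, hW] at this
    omega
  have h3 : cliqueCount G W 3 = 50 := by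
    have h4 : ∀ v ∈ W, cliqueCount G (_root_.neighborsIn G W v) 2 = 15 := by
      intro v hv
      have h5 := (h.neighborsIn hv).sum_card_nonneighborsIn_eq (hnb v hv)
      have h6 := sum_card_neighborsIn (G := G) (_root_.neighborsIn G W v)
      have h7 : ∑ x ∈ _root_.neighborsIn G W v,
          (1 + #(_root_.neighborsIn G (_root_.neighborsIn G W v) x) +
            #(nonneighborsIn G (_root_.neighborsIn G W v) x)) =
          ∑ x ∈ _root_.neighborsIn G W v, 7 := by
        refine sum_congr rfl fun x hx => ?_
        rw [← card_eq_neighborsIn_add_nonneighborsIn hx, hnb v hv]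
      simp only [sum_add_distrib, sum_const, smul_eq_mul, hnb v hv] at h7
      omega
    have : ∑ v ∈ W, cliqueCount G (_root_.neighborsIn G W v) 2 = 3 * cliqueCount G W 3 :=
      sum_cliqueCount_neighborsIn (G := G) W 2
    rw [sum_congr rfl h4, sum_const, smul_eq_mul, hW] at this
    omega
  have h4 : cliqueCount G W 4 = 25 := by omega
  rw [h.cliqueHPoly_eq]
  simp only [sum_range_succ, range_zero, sum_empty, cliqueCount_zero, cliqueCount_one, h2, h3, h4,
    hW]
  norm_num
  ring

/-- The `h`-polynomials of flag pseudomanifolds with few vertices. -/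
theorem cliqueHPoly_of_card_le (h : IsFlagPseudomanifold G d W) (hW : #W ≤ 2 * d + 2) :
    cliqueHPoly G d W = (1 + X) ^ d ∨
    (2 ≤ d ∧ cliqueHPoly G d W = (1 + X) ^ d + X * (1 + X) ^ (d - 2)) ∨
    (2 ≤ d ∧ cliqueHPoly G d W = (1 + X) ^ d + 2 * X * (1 + X) ^ (d - 2)) ∨
    (4 ≤ d ∧ cliqueHPoly G d W = (1 + X) ^ d + 2 * X * (1 + X) ^ (d - 2) +
      X ^ 2 * (1 + X) ^ (d - 4)) := by
  induction d generalizing W with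
  | zero =>
    left
    rw [h.cliqueHPoly_eq]
    simp [cliqueCount_zero]
  | succ d ih =>
    by_cases hno : ∀ v ∈ W, #(nonneighborsIn G W v) ≠ 1
    · obtain ⟨v, hv⟩ := h.nonempty
      have hlow := h.two_le_card_nonneighborsIn hno hv
      have hupp := h.card_nonneighborsIn_le hv
      rcases (by omega : #W = 2 * (d + 1) + 1 ∨ #W = 2 * (d + 1) + 2) with hW' | hW'
      · obtain ⟨hd, -⟩ := h.eq_two_of_card_eq hW' hno
        obtain rfl : d = 1 := by omega
        refine Or.inr (Or.inl ⟨le_rfl, ?_⟩)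
        rw [h.cliqueHPoly_of_card_eq (Or.inl hW'), hW']
        norm_num
      · rcases (by omega : d = 0 ∨ d = 1 ∨ d = 2 ∨ 3 ≤ d) with rfl | rfl | rfl | hd
        · have := h.card_eq_two
          omega
        · refine Or.inr (Or.inr (Or.inl ⟨le_rfl, ?_⟩))
          rw [h.cliqueHPoly_of_card_eq (Or.inr hW'), hW']
          norm_num
        · refine Or.inr (Or.inr (Or.inl ⟨by norm_num, ?_⟩))
          simpa using h.cliqueHPoly_three hW' hno
        · obtain ⟨hd4, hh⟩ := h.cliqueHPoly_of_four_le (by omega) hW' hno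
          obtain rfl : d = 3 := by omega
          refine Or.inr (Or.inr (Or.inr ⟨le_rfl, ?_⟩))
          simpa using hh
    · push Not at hno
      obtain ⟨v, hv, hone⟩ := hno
      have hcard := card_eq_neighborsIn_add_nonneighborsIn (G := G) hv
      rw [h.cliqueHPoly_of_suspension hv hone]
      rcases ih (h.neighborsIn hv) (by omega) with hh | ⟨hd, hh⟩ | ⟨hd, hh⟩ | ⟨hd, hh⟩
      · left
        rw [hh, pow_succ, mul_comm]
      · obtain ⟨e, rfl⟩ := Nat.exists_eq_add_of_le' hd
        refine Or.inr (Or.inl ⟨by omega, ?_⟩)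
        rw [hh, Nat.add_sub_cancel, show e + 2 + 1 - 2 = e + 1 by omega]
        ring
      · obtain ⟨e, rfl⟩ := Nat.exists_eq_add_of_le' hd
        refine Or.inr (Or.inr (Or.inl ⟨by omega, ?_⟩))
        rw [hh, Nat.add_sub_cancel, show e + 2 + 1 - 2 = e + 1 by omega]
        ring
      · obtain ⟨e, rfl⟩ := Nat.exists_eq_add_of_le' hd
        refine Or.inr (Or.inr (Or.inr ⟨by omega, ?_⟩))
        rw [hh, Nat.add_sub_cancel, show e + 4 + 1 - 2 = e + 3 by omega,
          show e + 4 - 2 = e + 2 by omega, show e + 4 + 1 - 4 = e + 1 by omega]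
        ring

end IsFlagPseudomanifold

end FlagPseudomanifold

section FlagSphere

variable {N : ℕ} {Δ : Finset (Finset (Fin N))}

/-- The graph formed by the edges of `Δ`. -/
def edgeGraph (Δ : Finset (Finset (Fin N))) : SimpleGraph (Fin N) where
  Adj a b := a ≠ b ∧ {a, b} ∈ Δ
  symm := ⟨fun a b h => ⟨h.1.symm, by rw [pair_comm]; exact h.2⟩⟩
  loopless := ⟨fun a h => h.1 rfl⟩

instance : DecidableRel (edgeGraph Δ).Adj := fun a b =>
  inferInstanceAs (Decidable (a ≠ b ∧ {a, b} ∈ Δ))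

theorem cliquesIn_edgeGraph (hdown : ∀ F ∈ Δ, ∀ G ⊆ F, G ∈ Δ)
    (hflag : ∀ F : Finset (Fin N), (∀ a ∈ F, ∀ b ∈ F, a ≠ b → {a, b} ∈ Δ) → F ∈ Δ) :
    cliquesIn (edgeGraph Δ) univ = Δ := by
  ext F
  rw [mem_cliquesIn]
  refine ⟨fun h => hflag F fun a ha b hb hab => (h.2 a ha b hb hab).2, fun h =>
    ⟨subset_univ F, fun a ha b hb hab => ⟨hab, hdown F h _ ?_⟩⟩⟩
  exact insert_subset ha (singleton_subset_iff.mpr hb)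

theorem commonNeighborsIn_edgeGraph (hdown : ∀ F ∈ Δ, ∀ G ⊆ F, G ∈ Δ)
    (hflag : ∀ F : Finset (Fin N), (∀ a ∈ F, ∀ b ∈ F, a ≠ b → {a, b} ∈ Δ) → F ∈ Δ)
    {K : Finset (Fin N)} (hK : K ∈ Δ) :
    commonNeighborsIn (edgeGraph Δ) univ K =
      univ.filter fun v => v ∉ K ∧ insert v K ∈ Δ := by
  ext v
  simp only [commonNeighborsIn, mem_filter, mem_univ, true_and]
  constructor
  · intro h
    refine ⟨fun hv => (h v hv).1 rfl, hflag _ fun a ha b hb hab => ?_⟩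
    rcases mem_insert.mp ha with rfl | haK <;> rcases mem_insert.mp hb with rfl | hbK
    · exact absurd rfl hab
    · exact (h b hbK).2
    · rw [pair_comm]
      exact (h a haK).2
    · exact hdown K hK _ (insert_subset haK (singleton_subset_iff.mpr hbK))
  · rintro ⟨hv, h⟩ k hk
    refine ⟨fun e => hv (e ▸ hk), hdown _ h _ ?_⟩
    exact insert_subset (mem_insert_self v K)
      (singleton_subset_iff.mpr (mem_insert_of_mem hk))

theorem isFlagPseudomanifold_of_sphere {n : ℕ} (hdown : ∀ F ∈ Δ, ∀ G ⊆ F, G ∈ Δ)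
    (hflag : ∀ F : Finset (Fin N), (∀ a ∈ F, ∀ b ∈ F, a ≠ b → {a, b} ∈ Δ) → F ∈ Δ)
    (hcard : ∀ F ∈ Δ, #F ≤ n + 1)
    (φ : realize Δ ≃ₜ Metric.sphere (0 : EuclideanSpace ℝ (Fin (n + 1))) 1) :
    IsFlagPseudomanifold (edgeGraph Δ) (n + 1) univ where
  card_le := by rwa [cliquesIn_edgeGraph hdown hflag]
  two_le K hK hlt := by
    rw [cliquesIn_edgeGraph hdown hflag] at hK
    rw [commonNeighborsIn_edgeGraph hdown hflag hK]
    exact (card_insert_mem_of_sphere hdown φ hK (by omega)).1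
  eq_two K hK heq := by
    rw [cliquesIn_edgeGraph hdown hflag] at hK
    rw [commonNeighborsIn_edgeGraph hdown hflag hK]
    exact (card_insert_mem_of_sphere hdown φ hK (by omega)).2 (by omega)

theorem hPoly_of_sphere {d : ℕ} (hd : 1 ≤ d) (hN : N ≤ 2 * d + 2)
    (hdown : ∀ F ∈ Δ, ∀ G ⊆ F, G ∈ Δ)
    (hflag : ∀ F : Finset (Fin N), (∀ a ∈ F, ∀ b ∈ F, a ≠ b → {a, b} ∈ Δ) → F ∈ Δ)
    (hcard : ∀ F ∈ Δ, #F ≤ d)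
    (hφ : Nonempty (realize Δ ≃ₜ Metric.sphere (0 : EuclideanSpace ℝ (Fin d)) 1)) :
    hPoly d Δ = (1 + X) ^ d ∨
    hPoly d Δ = (1 + X) ^ d + X * (1 + X) ^ (d - 2) ∨
    hPoly d Δ = (1 + X) ^ d + 2 * X * (1 + X) ^ (d - 2) ∨
    hPoly d Δ = (1 + X) ^ d + 2 * X * (1 + X) ^ (d - 2) + X ^ 2 * (1 + X) ^ (d - 4) := by
  obtain ⟨n, rfl⟩ := Nat.exists_eq_add_of_le' hd
  obtain ⟨φ⟩ := hφ
  have h := isFlagPseudomanifold_of_sphere hdown hflag hcard φ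
  have hpoly : cliqueHPoly (edgeGraph Δ) (n + 1) univ = hPoly (n + 1) Δ := by
    rw [cliqueHPoly, hPoly, cliquesIn_edgeGraph hdown hflag]
  have key := h.cliqueHPoly_of_card_le (by simpa using hN)
  rw [hpoly] at key
  rcases key with h | ⟨-, h⟩ | ⟨-, h⟩ | ⟨-, h⟩
  exacts [Or.inl h, Or.inr (Or.inl h), Or.inr (Or.inr (Or.inl h)), Or.inr (Or.inr (Or.inr h))]

end FlagSphere

section Fan

variable {N d : ℕ}

/-- The union of the coordinate cones spanned by the faces of `Δ`. -/
def fanCone (Δ : Finset (Finset (Fin N))) : Set (Fin N → ℝ) :=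
  {x | ∃ F ∈ Δ, (∀ v, 0 ≤ x v) ∧ ∀ v, x v ≠ 0 → v ∈ F}

theorem smul_mem_fanCone {Δ : Finset (Finset (Fin N))} {x : Fin N → ℝ} (hx : x ∈ fanCone Δ)
    {c : ℝ} (hc : 0 ≤ c) : c • x ∈ fanCone Δ := by
  obtain ⟨F, hF, h0, hs⟩ := hx
  exact ⟨F, hF, fun v => mul_nonneg hc (h0 v), fun v hv => hs v (right_ne_zero_of_mul hv)⟩

theorem realize_eq_fanCone_inter (Δ : Finset (Finset (Fin N))) :
    realize Δ = fanCone Δ ∩ {x | ∑ v, x v = 1} := by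
  ext x
  constructor
  · rintro ⟨F, hF, h0, hs, h1⟩
    exact ⟨⟨F, hF, h0, hs⟩, h1⟩
  · rintro ⟨⟨F, hF, h0, hs⟩, h1⟩
    exact ⟨F, hF, h0, hs, h1⟩

theorem isCompact_realize (Δ : Finset (Finset (Fin N))) : IsCompact (realize Δ) := by
  have h : realize Δ = ⋃ F ∈ Δ, stdSimplex ℝ (Fin N) ∩ ⋂ v ∈ (univ \ F), {x | x v = 0} := by
    ext x
    simp only [realize, Set.mem_ofPred_eq, Set.mem_iUnion, Set.mem_inter_iff, stdSimplex,
      Set.mem_iInter, mem_sdiff, mem_univ, true_and, exists_prop]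
    refine exists_congr fun F => and_congr_right fun _ => ⟨?_, ?_⟩
    · rintro ⟨h0, hs, h1⟩
      exact ⟨⟨h0, h1⟩, fun v hv => by_contra fun hx => hv (hs v hx)⟩
    · rintro ⟨⟨h0, h1⟩, hs⟩
      exact ⟨h0, fun v hx => by_contra fun hv => hx (hs v hv), h1⟩
  rw [h]
  refine Δ.isCompact_biUnion fun F _ => (isCompact_stdSimplex ℝ (Fin N)).inter_right ?_
  exact isClosed_biInter fun v _ => isClosed_eq (continuous_apply v) continuous_const

/-- A complete simplicial fan with face complex `Δ` exhibits `Δ` as a sphere. -/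
theorem nonempty_homeomorph_sphere_of_bijOn {E : Type*} [NormedAddCommGroup E] [NormedSpace ℝ E]
    {Δ : Finset (Finset (Fin N))} (hΔ : Δ.Nonempty) (π : (Fin N → ℝ) →ₗ[ℝ] E)
    (hπ : Set.BijOn π (fanCone Δ) Set.univ) :
    Nonempty (realize Δ ≃ₜ Metric.sphere (0 : E) 1) := by
  have hcone : realize Δ ⊆ fanCone Δ := by
    rw [realize_eq_fanCone_inter]
    exact Set.inter_subset_left
  have hzero : (0 : Fin N → ℝ) ∈ fanCone Δ := by
    obtain ⟨F, hF⟩ := hΔ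
    exact ⟨F, hF, fun _ => le_rfl, fun v hv => absurd rfl hv⟩
  have hsum : ∀ x ∈ realize Δ, ∑ v, x v = 1 := by
    rintro x ⟨F, hF, h0, hs, h1⟩
    exact h1
  have hne : ∀ x ∈ realize Δ, 0 < ‖π x‖ := by
    intro x hx
    rw [norm_pos_iff]
    intro h
    have : x = 0 := hπ.injOn (hcone hx) hzero (by rw [h, map_zero])
    have h1 := hsum x hx
    simp [this] at h1
  have hcont : Continuous π := π.continuous_of_finiteDimensional
  let f : realize Δ → Metric.sphere (0 : E) 1 := fun x =>
    ⟨‖π x‖⁻¹ • π x, by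
      rw [mem_sphere_zero_iff_norm, norm_smul, norm_inv, norm_norm,
        inv_mul_cancel₀ (hne x x.2).ne']⟩
  have hf : Continuous f := by
    refine Continuous.subtype_mk ?_ _
    refine Continuous.smul (Continuous.inv₀ ?_ fun x => (hne x x.2).ne') ?_
    · exact (hcont.comp continuous_subtype_val).norm
    · exact hcont.comp continuous_subtype_val
  have hbij : Function.Bijective f := by
    constructor
    · intro x y hxy
      have h1 : ‖π x‖⁻¹ • π x = ‖π y‖⁻¹ • π y := congrArg Subtype.val hxy
      rw [← map_smul, ← map_smul] at h1
      have h2 := hπ.injOn (smul_mem_fanCone (hcone x.2) (inv_nonneg.mpr (norm_nonneg _)))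
        (smul_mem_fanCone (hcone y.2) (inv_nonneg.mpr (norm_nonneg _))) h1
      have h3 : ‖π x‖⁻¹ = ‖π y‖⁻¹ := by
        have := congrArg (fun z : Fin N → ℝ => ∑ v, z v) h2
        simpa [← mul_sum, hsum x x.2, hsum y y.2] using this
      rw [h3] at h2
      exact Subtype.ext (smul_right_injective _ (inv_pos.mpr (hne y y.2)).ne' h2)
    · rintro ⟨u, hu⟩
      obtain ⟨z, hz, hzu⟩ := hπ.surjOn (Set.mem_univ u)
      have hu1 : ‖u‖ = 1 := mem_sphere_zero_iff_norm.mp hu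
      have hz0 : ∀ v, 0 ≤ z v := by
        obtain ⟨F, hF, h0, hs⟩ := hz
        exact h0
      have hpos : 0 < ∑ v, z v := by
        refine (sum_nonneg fun v _ => hz0 v).lt_of_ne' fun h => ?_
        have : z = 0 := funext fun v =>
          (sum_eq_zero_iff_of_nonneg fun v _ => hz0 v).mp h v (mem_univ v)
        rw [this, map_zero] at hzu
        simp [← hzu] at hu1
      refine ⟨⟨(∑ v, z v)⁻¹ • z, ?_⟩, Subtype.ext ?_⟩
      · rw [realize_eq_fanCone_inter]
        refine ⟨smul_mem_fanCone hz (inv_pos.mpr hpos).le, ?_⟩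
        simp [← mul_sum, inv_mul_cancel₀ hpos.ne']
      · change ‖π ((∑ v, z v)⁻¹ • z)‖⁻¹ • π ((∑ v, z v)⁻¹ • z) = u
        rw [map_smul, hzu, norm_smul, hu1, mul_one, norm_inv, Real.norm_of_nonneg hpos.le,
          inv_inv, smul_smul, mul_inv_cancel₀ hpos.ne', one_smul]
  have : CompactSpace (realize Δ) := isCompact_iff_compactSpace.mp (isCompact_realize Δ)
  exact ⟨Continuous.homeoOfEquivCompactToT2 (f := Equiv.ofBijective f hbij) hf⟩

/-- `Δ` is a flag complex which is the face complex of a complete fan in `ℝ^d`. -/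
structure IsCompleteFlagFan (d : ℕ) (Δ : Finset (Finset (Fin N))) : Prop where
  empty_mem : ∅ ∈ Δ
  mem_of_subset : ∀ F ∈ Δ, ∀ G ⊆ F, G ∈ Δ
  singleton_mem : ∀ p, {p} ∈ Δ
  mem_of_forall_pair_mem : ∀ F : Finset (Fin N),
    (∀ a ∈ F, ∀ b ∈ F, a ≠ b → ({a, b} : Finset (Fin N)) ∈ Δ) → F ∈ Δ
  card_le : ∀ F ∈ Δ, #F ≤ d
  exists_card_eq : ∃ F ∈ Δ, #F = d
  exists_bijOn : ∃ π : (Fin N → ℝ) →ₗ[ℝ] (Fin d → ℝ), Set.BijOn π (fanCone Δ) Set.univ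

theorem IsCompleteFlagFan.nonempty_homeomorph_sphere {Δ : Finset (Finset (Fin N))}
    (h : IsCompleteFlagFan d Δ) :
    Nonempty (realize Δ ≃ₜ Metric.sphere (0 : EuclideanSpace ℝ (Fin d)) 1) := by
  obtain ⟨π, hπ⟩ := h.exists_bijOn
  refine nonempty_homeomorph_sphere_of_bijOn ⟨∅, h.empty_mem⟩
    ((WithLp.linearEquiv 2 ℝ (Fin d → ℝ)).symm.toLinearMap ∘ₗ π) ?_
  exact (Set.bijOn_univ.mpr (WithLp.linearEquiv 2 ℝ (Fin d → ℝ)).symm.bijective).comp hπ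

theorem hPoly_eq_sum_range {Δ : Finset (Finset (Fin N))} (h : ∀ F ∈ Δ, #F ≤ d) :
    hPoly d Δ = ∑ k ∈ range (d + 1),
      (#{F ∈ Δ | #F = k} : ℤ[X]) * (X ^ k * (1 - X) ^ (d - k)) := by
  rw [hPoly, ← sum_fiberwise_of_maps_to (t := range (d + 1)) (g := card) fun K hK =>
    mem_range.mpr (Nat.lt_succ_of_le (h K hK))]
  refine sum_congr rfl fun k _ => ?_
  rw [sum_congr rfl fun K hK => by rw [(mem_filter.mp hK).2], sum_const, nsmul_eq_mul]

section Join

variable {M e : ℕ} {Δ : Finset (Finset (Fin N))} {Γ : Finset (Finset (Fin M))}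

/-- The part of `F` among the first `N` vertices. -/
def leftPart (F : Finset (Fin (N + M))) : Finset (Fin N) :=
  univ.filter fun i => Fin.castAdd M i ∈ F

/-- The part of `F` among the last `M` vertices. -/
def rightPart (F : Finset (Fin (N + M))) : Finset (Fin M) :=
  univ.filter fun j => Fin.natAdd N j ∈ F

/-- The face of a join formed by two faces of its constituents. -/
def joinFace (F : Finset (Fin N)) (G : Finset (Fin M)) : Finset (Fin (N + M)) :=
  F.map (Fin.castAddEmb M) ∪ G.map (Fin.natAddEmb N)

/-- The join of two simplicial complexes. -/
def complexJoin (Δ : Finset (Finset (Fin N))) (Γ : Finset (Finset (Fin M))) :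
    Finset (Finset (Fin (N + M))) :=
  univ.filter fun F => leftPart F ∈ Δ ∧ rightPart F ∈ Γ

theorem mem_leftPart {F : Finset (Fin (N + M))} {i : Fin N} :
    i ∈ leftPart F ↔ Fin.castAdd M i ∈ F := by
  simp [leftPart]

theorem mem_rightPart {F : Finset (Fin (N + M))} {j : Fin M} :
    j ∈ rightPart F ↔ Fin.natAdd N j ∈ F := by
  simp [rightPart]

theorem castAdd_mem_joinFace {F : Finset (Fin N)} {G : Finset (Fin M)} {i : Fin N} :
    Fin.castAdd M i ∈ joinFace F G ↔ i ∈ F := by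
  simp only [joinFace, mem_union, mem_map, Fin.castAddEmb_apply, Fin.natAddEmb_apply]
  constructor
  · rintro (⟨a, ha, h⟩ | ⟨b, -, h⟩)
    · exact Fin.castAdd_injective N M h ▸ ha
    · have := congrArg Fin.val h
      simp only [Fin.val_natAdd, Fin.val_castAdd] at this
      omega
  · exact fun h => Or.inl ⟨i, h, rfl⟩

theorem natAdd_mem_joinFace {F : Finset (Fin N)} {G : Finset (Fin M)} {j : Fin M} :
    Fin.natAdd N j ∈ joinFace F G ↔ j ∈ G := by
  simp only [joinFace, mem_union, mem_map, Fin.castAddEmb_apply, Fin.natAddEmb_apply]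
  constructor
  · rintro (⟨a, -, h⟩ | ⟨b, hb, h⟩)
    · have := congrArg Fin.val h
      simp only [Fin.val_natAdd, Fin.val_castAdd] at this
      omega
    · exact Fin.natAdd_injective M N h ▸ hb
  · exact fun h => Or.inr ⟨j, h, rfl⟩

theorem leftPart_joinFace (F : Finset (Fin N)) (G : Finset (Fin M)) :
    leftPart (joinFace F G) = F := by
  ext i
  rw [mem_leftPart, castAdd_mem_joinFace]

theorem rightPart_joinFace (F : Finset (Fin N)) (G : Finset (Fin M)) :
    rightPart (joinFace F G) = G := by
  ext i
  rw [mem_rightPart, natAdd_mem_joinFace]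

theorem joinFace_leftPart_rightPart (F : Finset (Fin (N + M))) :
    joinFace (leftPart F) (rightPart F) = F := by
  ext v
  induction v using Fin.addCases with
  | left i => rw [castAdd_mem_joinFace, mem_leftPart]
  | right j => rw [natAdd_mem_joinFace, mem_rightPart]

theorem mem_complexJoin {F : Finset (Fin (N + M))} :
    F ∈ complexJoin Δ Γ ↔ leftPart F ∈ Δ ∧ rightPart F ∈ Γ := by
  simp [complexJoin]

theorem joinFace_mem_complexJoin {F : Finset (Fin N)} {G : Finset (Fin M)} (hF : F ∈ Δ)
    (hG : G ∈ Γ) : joinFace F G ∈ complexJoin Δ Γ := by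
  rw [mem_complexJoin, leftPart_joinFace, rightPart_joinFace]
  exact ⟨hF, hG⟩

theorem card_joinFace (F : Finset (Fin N)) (G : Finset (Fin M)) :
    #(joinFace F G) = #F + #G := by
  rw [joinFace, card_union_of_disjoint, card_map, card_map]
  rw [disjoint_left]
  intro v hF hG
  obtain ⟨i, -, rfl⟩ := mem_map.mp hF
  obtain ⟨j, -, h⟩ := mem_map.mp hG
  have := congrArg Fin.val h
  simp only [Fin.natAddEmb_apply, Fin.castAddEmb_apply, Fin.val_natAdd, Fin.val_castAdd] at this
  omega

theorem hPoly_complexJoin (hΔ : ∀ F ∈ Δ, #F ≤ d) (hΓ : ∀ G ∈ Γ, #G ≤ e) :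
    hPoly (d + e) (complexJoin Δ Γ) = hPoly d Δ * hPoly e Γ := by
  rw [hPoly, hPoly, hPoly, sum_mul_sum, ← sum_product']
  refine sum_bij' (fun F _ => (leftPart F, rightPart F)) (fun p _ => joinFace p.1 p.2)
    (fun F hF => mem_product.mpr (mem_complexJoin.mp hF))
    (fun p hp => joinFace_mem_complexJoin (mem_product.mp hp).1 (mem_product.mp hp).2)
    (fun F _ => joinFace_leftPart_rightPart F)
    (fun p _ => Prod.ext (leftPart_joinFace _ _) (rightPart_joinFace _ _)) fun F hF => ?_
  have h1 := hΔ _ (mem_complexJoin.mp hF).1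
  have h2 := hΓ _ (mem_complexJoin.mp hF).2
  have h3 : #F = #(leftPart F) + #(rightPart F) := by
    rw [← card_joinFace, joinFace_leftPart_rightPart]
  rw [h3, show d + e - (#(leftPart F) + #(rightPart F)) =
    (d - #(leftPart F)) + (e - #(rightPart F)) by omega]
  ring

theorem mem_fanCone_complexJoin {x : Fin (N + M) → ℝ} :
    x ∈ fanCone (complexJoin Δ Γ) ↔ (fun i => x (Fin.castAdd M i)) ∈ fanCone Δ ∧
      (fun j => x (Fin.natAdd N j)) ∈ fanCone Γ := by
  constructor
  · rintro ⟨F, hF, h0, hs⟩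
    rw [mem_complexJoin] at hF
    exact ⟨⟨_, hF.1, fun _ => h0 _, fun i hi => mem_leftPart.mpr (hs _ hi)⟩,
      ⟨_, hF.2, fun _ => h0 _, fun i hi => mem_rightPart.mpr (hs _ hi)⟩⟩
  · rintro ⟨⟨F, hF, hF0, hFs⟩, ⟨G, hG, hG0, hGs⟩⟩
    refine ⟨joinFace F G, joinFace_mem_complexJoin hF hG, fun v => ?_, fun v hv => ?_⟩
    · induction v using Fin.addCases with
      | left i => exact hF0 i
      | right j => exact hG0 j
    · induction v using Fin.addCases with
      | left i => exact castAdd_mem_joinFace.mpr (hFs i hv)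
      | right j => exact natAdd_mem_joinFace.mpr (hGs j hv)

theorem IsCompleteFlagFan.complexJoin (hΔ : IsCompleteFlagFan d Δ) (hΓ : IsCompleteFlagFan e Γ) :
    IsCompleteFlagFan (d + e) (complexJoin Δ Γ) where
  empty_mem := by
    rw [mem_complexJoin]
    exact ⟨hΔ.mem_of_subset _ hΔ.empty_mem _ (by simp [leftPart]),
      hΓ.mem_of_subset _ hΓ.empty_mem _ (by simp [rightPart])⟩
  mem_of_subset F hF G hGF := by
    rw [mem_complexJoin] at hF ⊢
    refine ⟨hΔ.mem_of_subset _ hF.1 _ fun i hi => ?_, hΓ.mem_of_subset _ hF.2 _ fun j hj => ?_⟩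
    · exact mem_leftPart.mpr (hGF (mem_leftPart.mp hi))
    · exact mem_rightPart.mpr (hGF (mem_rightPart.mp hj))
  singleton_mem p := by
    rw [mem_complexJoin]
    constructor
    · refine hΔ.mem_of_forall_pair_mem _ fun a ha b hb hab => absurd ?_ hab
      rw [mem_leftPart, mem_singleton] at ha hb
      exact Fin.castAdd_injective N M (ha.trans hb.symm)
    · refine hΓ.mem_of_forall_pair_mem _ fun a ha b hb hab => absurd ?_ hab
      rw [mem_rightPart, mem_singleton] at ha hb
      exact Fin.natAdd_injective M N (ha.trans hb.symm)
  mem_of_forall_pair_mem F hF := by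
    rw [mem_complexJoin]
    constructor
    · refine hΔ.mem_of_forall_pair_mem _ fun a ha b hb hab => ?_
      refine hΔ.mem_of_subset _ (mem_complexJoin.mp (hF _ (mem_leftPart.mp ha) _
        (mem_leftPart.mp hb) ((Fin.castAdd_injective N M).ne hab))).1 _ fun c hc => ?_
      rw [mem_leftPart]
      rcases mem_insert.mp hc with rfl | hc
      · exact mem_insert_self _ _
      · rw [mem_singleton.mp hc]
        exact mem_insert_of_mem (mem_singleton_self _)
    · refine hΓ.mem_of_forall_pair_mem _ fun a ha b hb hab => ?_
      refine hΓ.mem_of_subset _ (mem_complexJoin.mp (hF _ (mem_rightPart.mp ha) _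
        (mem_rightPart.mp hb) ((Fin.natAdd_injective M N).ne hab))).2 _ fun c hc => ?_
      rw [mem_rightPart]
      rcases mem_insert.mp hc with rfl | hc
      · exact mem_insert_self _ _
      · rw [mem_singleton.mp hc]
        exact mem_insert_of_mem (mem_singleton_self _)
  card_le F hF := by
    rw [← joinFace_leftPart_rightPart F, card_joinFace]
    exact Nat.add_le_add (hΔ.card_le _ (mem_complexJoin.mp hF).1)
      (hΓ.card_le _ (mem_complexJoin.mp hF).2)
  exists_card_eq := by
    obtain ⟨F, hF, rfl⟩ := hΔ.exists_card_eq
    obtain ⟨G, hG, rfl⟩ := hΓ.exists_card_eq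
    exact ⟨_, joinFace_mem_complexJoin hF hG, card_joinFace F G⟩
  exists_bijOn := by
    obtain ⟨π, hπ⟩ := hΔ.exists_bijOn
    obtain ⟨ρ, hρ⟩ := hΓ.exists_bijOn
    let τ : (Fin (N + M) → ℝ) →ₗ[ℝ] (Fin (d + e) → ℝ) :=
      { toFun x := Fin.append (π fun i => x (Fin.castAdd M i)) (ρ fun j => x (Fin.natAdd N j))
        map_add' x y := by
          ext v
          induction v using Fin.addCases with
          | left i =>
            simp only [Fin.append_left, Pi.add_apply]
            exact congrFun (π.map_add (fun i => x (Fin.castAdd M i)) fun i => y (Fin.castAdd M i)) i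
          | right j =>
            simp only [Fin.append_right, Pi.add_apply]
            exact congrFun (ρ.map_add (fun j => x (Fin.natAdd N j)) fun j => y (Fin.natAdd N j)) j
        map_smul' c x := by
          ext v
          induction v using Fin.addCases with
          | left i =>
            simp only [Fin.append_left, Pi.smul_apply]
            exact congrFun (π.map_smul c fun i => x (Fin.castAdd M i)) i
          | right j =>
            simp only [Fin.append_right, Pi.smul_apply]
            exact congrFun (ρ.map_smul c fun j => x (Fin.natAdd N j)) j }
    have hτ : ∀ x, τ x = Fin.append (π fun i => x (Fin.castAdd M i))
      (ρ fun j => x (Fin.natAdd N j)) := fun _ => rfl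
    refine ⟨τ, fun _ _ => Set.mem_univ _, fun x hx y hy hxy => ?_, fun u _ => ?_⟩
    · rw [mem_fanCone_complexJoin] at hx hy
      rw [hτ, hτ] at hxy
      have h1 := hπ.injOn hx.1 hy.1 (funext fun i => by
        simpa using congrFun hxy (Fin.castAdd e i))
      have h2 := hρ.injOn hx.2 hy.2 (funext fun j => by
        simpa using congrFun hxy (Fin.natAdd d j))
      ext v
      induction v using Fin.addCases with
      | left i => exact congrFun h1 i
      | right j => exact congrFun h2 j
    · obtain ⟨x, hx, hxu⟩ := hπ.surjOn (Set.mem_univ fun i => u (Fin.castAdd e i))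
      obtain ⟨y, hy, hyu⟩ := hρ.surjOn (Set.mem_univ fun j => u (Fin.natAdd d j))
      refine ⟨Fin.append x y, ?_, ?_⟩
      · rw [mem_fanCone_complexJoin]
        simpa using ⟨hx, hy⟩
      · rw [hτ]
        ext v
        induction v using Fin.addCases with
        | left i => simpa using congrFun hxu i
        | right j => simpa using congrFun hyu j

end Join

section Polygon

/-- The boundary complex of the polygon with `n` vertices. -/
def polygonBoundary (n : ℕ) [NeZero n] : Finset (Finset (Fin n)) :=
  univ.biUnion fun i : Fin n => ({i, i + 1} : Finset (Fin n)).powerset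

theorem mem_fanCone_polygonBoundary {n : ℕ} [NeZero n] {x : Fin n → ℝ} :
    x ∈ fanCone (polygonBoundary n) ↔
      ∃ i, (∀ v, 0 ≤ x v) ∧ ∀ v, x v ≠ 0 → v = i ∨ v = i + 1 := by
  constructor
  · rintro ⟨F, hF, h0, hs⟩
    obtain ⟨i, -, hi⟩ := mem_biUnion.mp hF
    exact ⟨i, h0, fun v hv => by simpa using mem_powerset.mp hi (hs v hv)⟩
  · rintro ⟨i, h0, hs⟩
    exact ⟨{i, i + 1}, mem_biUnion.mpr ⟨i, mem_univ i, mem_powerset_self _⟩, h0,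
      fun v hv => by simpa using hs v hv⟩

theorem isCompleteFlagFan_polygonBoundary {n : ℕ} [NeZero n]
    (hcard : ∀ i : Fin n, i ≠ i + 1)
    (hflag : ∀ F : Finset (Fin n), (∀ a ∈ F, ∀ b ∈ F, a ≠ b →
      ({a, b} : Finset (Fin n)) ∈ polygonBoundary n) → F ∈ polygonBoundary n)
    (A : Matrix (Fin 2) (Fin n) ℝ) (σ : (Fin 2 → ℝ) → Fin n → ℝ)
    (hσ : ∀ u, σ u ∈ fanCone (polygonBoundary n)) (hAσ : ∀ u, A.mulVec (σ u) = u)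
    (hσA : ∀ x ∈ fanCone (polygonBoundary n), σ (A.mulVec x) = x) :
    IsCompleteFlagFan 2 (polygonBoundary n) where
  empty_mem := mem_biUnion.mpr ⟨0, mem_univ _, empty_mem_powerset _⟩
  mem_of_subset F hF G hGF := by
    obtain ⟨i, hi, hFi⟩ := mem_biUnion.mp hF
    exact mem_biUnion.mpr ⟨i, hi, mem_powerset.mpr (hGF.trans (mem_powerset.mp hFi))⟩
  singleton_mem p := mem_biUnion.mpr ⟨p, mem_univ p, by simp⟩
  mem_of_forall_pair_mem := hflag
  card_le F hF := by
    obtain ⟨i, -, hi⟩ := mem_biUnion.mp hF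
    exact (card_le_card (mem_powerset.mp hi)).trans card_le_two
  exists_card_eq := ⟨{0, 0 + 1}, mem_biUnion.mpr ⟨0, mem_univ _, mem_powerset_self _⟩,
    card_pair (hcard 0)⟩
  exists_bijOn := by
    refine ⟨A.mulVecLin, fun _ _ => Set.mem_univ _, fun x hx y hy hxy => ?_, fun u _ =>
      ⟨σ u, hσ u, hAσ u⟩⟩
    rw [← hσA x hx, ← hσA y hy]
    exact congrArg σ hxy

theorem isCompleteFlagFan_square : IsCompleteFlagFan 2 (polygonBoundary 4) := by
  refine isCompleteFlagFan_polygonBoundary (by decide) (by decide +kernel)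
    !![1, 0, -1, 0; 0, 1, 0, -1]
    (fun u => ![max 0 (u 0), max 0 (u 1), max 0 (-u 0), max 0 (-u 1)])
    (fun u => ?_) (fun u => ?_) fun x hx => ?_
  · simp only [mem_fanCone_polygonBoundary, Fin.exists_fin_succ, Fin.forall_fin_succ, Fin.isValue]
    simp
    grind
  · ext i
    fin_cases i <;>
    · simp [Matrix.mulVec, dotProduct, Fin.sum_univ_succ]
      grind
  · obtain ⟨i, h0, hs⟩ := mem_fanCone_polygonBoundary.mp hx
    simp [funext_iff, Matrix.mulVec, dotProduct, Fin.sum_univ_succ, Fin.forall_fin_succ] at h0 hs ⊢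
    fin_cases i <;> simp at hs <;> simp [hs] <;> grind

theorem isCompleteFlagFan_pentagon : IsCompleteFlagFan 2 (polygonBoundary 5) := by
  refine isCompleteFlagFan_polygonBoundary (by decide) (by decide +kernel)
    !![1, 1, 0, -1, 0; 0, 1, 1, 0, -1]
    (fun u => ![max 0 (u 0 - max 0 (u 1)), max 0 (min (u 0) (u 1)), max 0 (u 1 - max 0 (u 0)),
      max 0 (-u 0), max 0 (-u 1)])
    (fun u => ?_) (fun u => ?_) fun x hx => ?_
  · simp only [mem_fanCone_polygonBoundary, Fin.exists_fin_succ, Fin.forall_fin_succ, Fin.isValue]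
    simp
    grind
  · ext i
    fin_cases i <;>
    · simp [Matrix.mulVec, dotProduct, Fin.sum_univ_succ]
      grind
  · obtain ⟨i, h0, hs⟩ := mem_fanCone_polygonBoundary.mp hx
    simp [funext_iff, Matrix.mulVec, dotProduct, Fin.sum_univ_succ, Fin.forall_fin_succ] at h0 hs ⊢
    fin_cases i <;> simp at hs <;> simp [hs] <;> grind

theorem isCompleteFlagFan_hexagon : IsCompleteFlagFan 2 (polygonBoundary 6) := by
  refine isCompleteFlagFan_polygonBoundary (by decide) (by decide +kernel)
    !![1, 1, 0, -1, -1, 0; 0, 1, 1, 0, -1, -1]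
    (fun u => ![max 0 (u 0 - max 0 (u 1)), max 0 (min (u 0) (u 1)), max 0 (u 1 - max 0 (u 0)),
      max 0 (-u 0 - max 0 (-u 1)), max 0 (min (-u 0) (-u 1)), max 0 (-u 1 - max 0 (-u 0))])
    (fun u => ?_) (fun u => ?_) fun x hx => ?_
  · simp only [mem_fanCone_polygonBoundary, Fin.exists_fin_succ, Fin.forall_fin_succ, Fin.isValue]
    simp
    grind
  · ext i
    fin_cases i <;>
    · simp [Matrix.mulVec, dotProduct, Fin.sum_univ_succ]
      grind
  · obtain ⟨i, h0, hs⟩ := mem_fanCone_polygonBoundary.mp hx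
    simp [funext_iff, Matrix.mulVec, dotProduct, Fin.sum_univ_succ, Fin.forall_fin_succ] at h0 hs ⊢
    fin_cases i <;> simp at hs <;> simp [hs] <;> grind

theorem hPoly_square : hPoly 2 (polygonBoundary 4) = (1 + X) ^ 2 := by
  rw [hPoly_eq_sum_range isCompleteFlagFan_square.card_le]
  simp only [sum_range_succ, range_zero, sum_empty,
    show #{F ∈ polygonBoundary 4 | #F = 0} = 1 by decide +kernel,
    show #{F ∈ polygonBoundary 4 | #F = 1} = 4 by decide +kernel,
    show #{F ∈ polygonBoundary 4 | #F = 2} = 4 by decide +kernel]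
  norm_num
  ring

theorem hPoly_pentagon : hPoly 2 (polygonBoundary 5) = (1 + X) ^ 2 + X := by
  rw [hPoly_eq_sum_range isCompleteFlagFan_pentagon.card_le]
  simp only [sum_range_succ, range_zero, sum_empty,
    show #{F ∈ polygonBoundary 5 | #F = 0} = 1 by decide +kernel,
    show #{F ∈ polygonBoundary 5 | #F = 1} = 5 by decide +kernel,
    show #{F ∈ polygonBoundary 5 | #F = 2} = 5 by decide +kernel]
  norm_num
  ring

theorem hPoly_hexagon : hPoly 2 (polygonBoundary 6) = (1 + X) ^ 2 + 2 * X := by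
  rw [hPoly_eq_sum_range isCompleteFlagFan_hexagon.card_le]
  simp only [sum_range_succ, range_zero, sum_empty,
    show #{F ∈ polygonBoundary 6 | #F = 0} = 1 by decide +kernel,
    show #{F ∈ polygonBoundary 6 | #F = 1} = 6 by decide +kernel,
    show #{F ∈ polygonBoundary 6 | #F = 2} = 6 by decide +kernel]
  norm_num
  ring

end Polygon

end Fan

theorem exists_flag_sphere_hPoly (g : ℕ × ℕ)
    (hg : g ∈ ([(0, 0), (1, 0), (2, 0), (2, 1)] : List (ℕ × ℕ))) :
    ∃ (d N : ℕ) (Δ : Finset (Finset (Fin N))), 1 ≤ d ∧ IsCompleteFlagFan d Δ ∧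
      hPoly d Δ = (1 + X) ^ d + (g.1 : ℤ[X]) * X * (1 + X) ^ (d - 2) +
        (g.2 : ℤ[X]) * X ^ 2 * (1 + X) ^ (d - 4) := by
  simp only [List.mem_cons, List.not_mem_nil, or_false] at hg
  rcases hg with rfl | rfl | rfl | rfl
  · exact ⟨2, 4, _, by norm_num, isCompleteFlagFan_square, by rw [hPoly_square]; simp⟩
  · exact ⟨2, 5, _, by norm_num, isCompleteFlagFan_pentagon, by rw [hPoly_pentagon]; simp⟩
  · exact ⟨2, 6, _, by norm_num, isCompleteFlagFan_hexagon, by rw [hPoly_hexagon]; simp⟩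
  · refine ⟨2 + 2, 5 + 5, _, by norm_num,
      isCompleteFlagFan_pentagon.complexJoin isCompleteFlagFan_pentagon, ?_⟩
    rw [hPoly_complexJoin isCompleteFlagFan_pentagon.card_le isCompleteFlagFan_pentagon.card_le,
      hPoly_pentagon]
    norm_num
    ring

/-- Flag spheres with few vertices.  If `Δ` is a flag simplicial complex of
dimension `d-1` whose geometric realization is homeomorphic to `S^{d-1}` and which
has at most `2d+2` vertices (i.e. `γ₁(Δ) ≤ 2`), then the `γ`-polynomial of `Δ` is
one of `1`, `1+t`, `1+2t`, `1+2t+t²` (in particular `γ(Δ)` satisfies the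
Kruskal–Katona inequalities: it is the `f`-vector of a simplicial complex).
Moreover, each of these four polynomials occurs as `γ(Δ;t)` for some flag
simplicial complex `Δ` realized as a sphere. -/
theorem flag_sphere_small_gamma :
    (∀ d : ℕ, 1 ≤ d → ∀ N : ℕ, N ≤ 2 * d + 2 →
      ∀ Δ : Finset (Finset (Fin N)),
      ∅ ∈ Δ →
      (∀ F ∈ Δ, ∀ G ⊆ F, G ∈ Δ) →
      (∀ p : Fin N, ({p} : Finset (Fin N)) ∈ Δ) →
      (∀ F : Finset (Fin N),
        (∀ a ∈ F, ∀ b ∈ F, a ≠ b → ({a, b} : Finset (Fin N)) ∈ Δ) → F ∈ Δ) →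
      (∀ F ∈ Δ, F.card ≤ d) →
      (∃ F ∈ Δ, F.card = d) →
      Nonempty (realize Δ ≃ₜ Metric.sphere (0 : EuclideanSpace ℝ (Fin d)) 1) →
      (hPoly d Δ = (1 + X) ^ d ∨
       hPoly d Δ = (1 + X) ^ d + X * (1 + X) ^ (d - 2) ∨
       hPoly d Δ = (1 + X) ^ d + 2 * X * (1 + X) ^ (d - 2) ∨
       hPoly d Δ = (1 + X) ^ d + 2 * X * (1 + X) ^ (d - 2) +
         X ^ 2 * (1 + X) ^ (d - 4))) ∧
    (∀ g ∈ ([(0, 0), (1, 0), (2, 0), (2, 1)] : List (ℕ × ℕ)),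
      ∃ (d N : ℕ) (Δ : Finset (Finset (Fin N))), 1 ≤ d ∧
        ∅ ∈ Δ ∧
        (∀ F ∈ Δ, ∀ G ⊆ F, G ∈ Δ) ∧
        (∀ p : Fin N, ({p} : Finset (Fin N)) ∈ Δ) ∧
        (∀ F : Finset (Fin N),
          (∀ a ∈ F, ∀ b ∈ F, a ≠ b → ({a, b} : Finset (Fin N)) ∈ Δ) → F ∈ Δ) ∧
        (∀ F ∈ Δ, F.card ≤ d) ∧
        (∃ F ∈ Δ, F.card = d) ∧
        Nonempty (realize Δ ≃ₜ Metric.sphere (0 : EuclideanSpace ℝ (Fin d)) 1) ∧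
        hPoly d Δ = (1 + X) ^ d + (g.1 : Polynomial ℤ) * X * (1 + X) ^ (d - 2) +
          (g.2 : Polynomial ℤ) * X ^ 2 * (1 + X) ^ (d - 4)) := by
  refine ⟨fun d hd N hN Δ _ hdown _ hflag hcard _ hφ =>
    hPoly_of_sphere hd hN hdown hflag hcard hφ, fun g hg => ?_⟩
  obtain ⟨d, N, Δ, hd, h, hpoly⟩ := exists_flag_sphere_hPoly g hg
  exact ⟨d, N, Δ, hd, h.empty_mem, h.mem_of_subset, h.singleton_mem, h.mem_of_forall_pair_mem,
    h.card_le, h.exists_card_eq, h.nonempty_homeomorph_sphere, hpoly⟩
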